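/- arXiv:2605.18590 — 8 statements merged into one kernel-verified Lean document; each statement's English description precedes it below -/
import Mathlib

section
/- Let p ≥ 1 be an integer and let f(z) = z^p + ∑_{n=p+1}^∞ a_n z^n be analytic in the open unit disc 𝔻. If for some α₁ ∈ (0,1] one has |arg f^{(p)}(z)| < (π/2)(α₁ + (2/π)·arctan α₁) for all z ∈ 𝔻, then |arg( f^{(p-1)}(z)/z )| < α₁π/2 for all z ∈ 𝔻, z ≠ 0. -/
open Complex Real
open Filter Topology

/-- A function vanishing at `0` and nonpositive to the right of `0` has nonpositive derivative
there. -/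
theorem HasDerivAt.nonpos_of_eventually_nonpos {F : ℝ → ℝ} {d : ℝ} (hF : HasDerivAt F d 0)
    (h0 : F 0 = 0) (hle : ∀ᶠ s in 𝓝[>] (0 : ℝ), F s ≤ 0) : d ≤ 0 := by
  have h := (hasDerivWithinAt_iff_tendsto_slope' (s := Set.Ioi 0) (by simp)).1 hF.hasDerivWithinAt
  refine le_of_tendsto h ?_
  filter_upwards [hle, self_mem_nhdsWithin] with s hs hs0
  rw [slope_def_field, h0, sub_zero, sub_zero]
  exact div_nonpos_of_nonpos_of_nonneg hs (le_of_lt hs0)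

theorem norm_one_add_mul_lt_one {s t : ℝ} (hs : 0 < s) (hst : s * (1 + t ^ 2) < 2) :
    ‖(1 : ℂ) + s * (-1 + t * I)‖ < 1 := by
  have h : ‖(1 : ℂ) + s * (-1 + t * I)‖ ^ 2 < 1 := by
    rw [← Complex.normSq_eq_norm_sq, Complex.normSq_apply]
    simp
    nlinarith
  nlinarith [norm_nonneg ((1 : ℂ) + s * (-1 + t * I))]

theorem eventually_mul_one_add_sq_lt_two (t : ℝ) :
    ∀ᶠ s in 𝓝[>] (0 : ℝ), 0 < s ∧ s * (1 + t ^ 2) < 2 := by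
  have h : ∀ᶠ s in 𝓝 (0 : ℝ), s * (1 + t ^ 2) < 2 :=
    (by fun_prop : Continuous fun s : ℝ => s * (1 + t ^ 2)).continuousAt.eventually_lt
      continuousAt_const (by simp)
  filter_upwards [self_mem_nhdsWithin, nhdsWithin_le_nhds h] with s hs h using ⟨hs, h⟩

theorem HasDerivAt.along_ray {g : ℂ → ℂ} {g' z : ℂ} (hg : HasDerivAt g g' z) (ζ : ℂ) :
    HasDerivAt (fun s : ℝ => g (z * (1 + s * ζ))) (z * g' * ζ) 0 := by
  have h1 : HasDerivAt (fun s : ℂ => z * (1 + s * ζ)) (z * ζ) ((0 : ℝ) : ℂ) := by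
    have := (((hasDerivAt_id ((0 : ℝ) : ℂ)).mul_const ζ).const_add 1).const_mul z
    simpa using this
  have h2 : HasDerivAt g g' (z * (1 + ((0 : ℝ) : ℂ) * ζ)) := by simpa using hg
  have := (h2.comp ((0 : ℝ) : ℂ) h1).comp_ofReal
  rwa [← mul_assoc, mul_comm g' z] at this

/-- **Jack's lemma.** -/
theorem jack_lemma {ω : ℂ → ℂ} {ω' z₀ : ℂ} {r : ℝ} (hr : 0 < r)
    (hd : DifferentiableOn ℂ ω (Metric.ball 0 r)) (hω : ∀ z ∈ Metric.ball (0 : ℂ) r, ‖ω z‖ < 1)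
    (h0 : ω 0 = 0) (hz₀ : ‖z₀‖ = r) (hd₀ : HasDerivAt ω ω' z₀) (h₁ : ‖ω z₀‖ = 1) :
    ∃ m : ℝ, 1 ≤ m ∧ z₀ * ω' = m * ω z₀ := by
  have hschwarz : ∀ z ∈ Metric.ball (0 : ℂ) r, ‖ω z‖ ≤ ‖z‖ / r := by
    intro z hz
    have := Complex.dist_le_div_mul_dist_of_mapsTo_ball (R₂ := 1) hd
      (fun w hw => by simpa [h0] using (hω w hw).le) hz
    simpa [h0, div_eq_inv_mul] using this
  have key : ∀ t : ℝ, ((starRingEnd ℂ (ω z₀) * (z₀ * ω') - 1) * (-1 + t * I)).re ≤ 0 := by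
    intro t
    have hA := (hd₀.along_ray (-1 + t * I)).norm_sq
    have hB := ((hasDerivAt_id z₀).along_ray (-1 + t * I)).norm_sq
    have hF := hA.sub (hB.div_const (r ^ 2))
    have hle := hF.nonpos_of_eventually_nonpos ?_ ?_
    · simp only [Complex.inner, id, Complex.ofReal_zero, zero_mul, add_zero, mul_one] at hle
      have e1 : (z₀ * (-1 + t * I) * starRingEnd ℂ z₀).re = r ^ 2 * (-1 : ℝ) := by
        rw [mul_right_comm, Complex.mul_conj, Complex.normSq_eq_norm_sq, hz₀, Complex.re_ofReal_mul]
        simp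
      rw [e1] at hle
      have e2 : (starRingEnd ℂ (ω z₀) * (z₀ * ω') - 1) * (-1 + t * I) =
        z₀ * ω' * (-1 + t * I) * starRingEnd ℂ (ω z₀) - (-1 + t * I) := by ring
      rw [e2, Complex.sub_re]
      have : 2 * (r ^ 2 * (-1 : ℝ)) / r ^ 2 = -2 := by field_simp
      rw [this] at hle
      have e3 : (-1 + t * I : ℂ).re = -1 := by simp
      rw [e3]
      linarith
    · simp [h₁, hz₀, hr.ne']
    · filter_upwards [eventually_mul_one_add_sq_lt_two t] with s hs
      have hlt := norm_one_add_mul_lt_one hs.1 hs.2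
      have hmem : z₀ * (1 + s * (-1 + t * I)) ∈ Metric.ball (0 : ℂ) r := by
        rw [mem_ball_zero_iff, norm_mul, hz₀]
        nlinarith
      have := hschwarz _ hmem
      simp only [Pi.sub_apply, id, sub_nonpos]
      rw [← div_pow]
      gcongr
  set w := starRingEnd ℂ (ω z₀) * (z₀ * ω') with hw
  have hkey : ∀ t : ℝ, -(w.re - 1) - t * w.im ≤ 0 := by
    intro t
    have := key t
    simp at this
    linarith
  have him : w.im = 0 := by
    by_contra hne
    have := hkey (-(w.re) / w.im)
    rw [div_mul_cancel₀ _ hne] at this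
    linarith
  refine ⟨w.re, by linarith [hkey 0], ?_⟩
  have hwre : (w.re : ℂ) = w := Complex.ext rfl (by simp [him])
  rw [hwre, hw, mul_right_comm, mul_comm (starRingEnd ℂ _), Complex.mul_conj,
    Complex.normSq_eq_norm_sq, h₁]
  simp

/-- Jack's lemma transported to the right half-plane. -/
theorem jack_lemma_halfPlane {P : ℂ → ℂ} {P' z₀ : ℂ} {r b : ℝ} (hr : 0 < r)
    (hd : DifferentiableOn ℂ P (Metric.ball 0 r)) (hP : ∀ z ∈ Metric.ball (0 : ℂ) r, 0 < (P z).re)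
    (h0 : P 0 = 1) (hz₀ : ‖z₀‖ = r) (hd₀ : HasDerivAt P P' z₀) (hb : P z₀ = b * I) :
    ∃ t : ℝ, (1 + b ^ 2) / 2 ≤ t ∧ z₀ * P' = -t := by
  have hne : ∀ {x : ℂ}, 0 ≤ x.re → x + 1 ≠ 0 := by
    intro x hx h
    have := congrArg Complex.re h
    simp at this
    linarith
  have hb0 : P z₀ + 1 ≠ 0 := hne (by simp [hb])
  have hdω := (hd₀.sub_const 1).div (hd₀.add_const 1) hb0
  have hlt : ∀ z ∈ Metric.ball (0 : ℂ) r, ‖(P z - 1) / (P z + 1)‖ < 1 := by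
    intro z hz
    have hpos := hP z hz
    rw [norm_div, div_lt_one (norm_pos_iff.2 (hne hpos.le)),
      ← sq_lt_sq₀ (norm_nonneg _) (norm_nonneg _), ← Complex.normSq_eq_norm_sq,
      ← Complex.normSq_eq_norm_sq, Complex.normSq_apply, Complex.normSq_apply]
    simp
    nlinarith
  have heq : ‖(P z₀ - 1) / (P z₀ + 1)‖ = 1 := by
    rw [norm_div, div_eq_one_iff_eq (norm_ne_zero_iff.2 hb0),
      ← sq_eq_sq₀ (norm_nonneg _) (norm_nonneg _), ← Complex.normSq_eq_norm_sq,
      ← Complex.normSq_eq_norm_sq, Complex.normSq_apply, Complex.normSq_apply]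
    simp [hb]
  obtain ⟨m, hm, hmeq⟩ := jack_lemma (ω := fun z => (P z - 1) / (P z + 1)) hr
    ((hd.sub_const 1).div (hd.add_const 1) fun z hz => hne (hP z hz).le) hlt (by simp [h0])
    hz₀ hdω heq
  refine ⟨m * ((1 + b ^ 2) / 2), by nlinarith [sq_nonneg b], ?_⟩
  rw [hb] at hmeq hb0
  field_simp at hmeq
  have h2 : z₀ * P' * 2 = m * ((b * I) ^ 2 - 1) := by
    linear_combination hmeq
  rw [mul_pow, I_sq] at h2
  push_cast
  linear_combination h2 / 2

/-- **Nunokawa's lemma**: the logarithmic derivative at the first point where the values leave a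
sector. -/
theorem nunokawa_lemma {q : ℂ → ℂ} {q' z₀ : ℂ} {r α ε : ℝ} (hr : 0 < r) (hα : 0 < α) (hα1 : α ≤ 1)
    (hε : ε = 1 ∨ ε = -1) (hd : DifferentiableOn ℂ q (Metric.ball 0 r))
    (hq : ∀ z ∈ Metric.ball (0 : ℂ) r, q z ≠ 0 ∧ |(q z).arg| < α * π / 2)
    (h0 : q 0 = 1) (hz₀ : ‖z₀‖ = r) (hd₀ : HasDerivAt q q' z₀) (hne : q z₀ ≠ 0)
    (harg : (q z₀).arg = ε * (α * π / 2)) :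
    ∃ κ : ℝ, α ≤ κ ∧ z₀ * q' = q z₀ * ((ε * κ : ℝ) * I) := by
  have hπ := Real.pi_pos
  have hslit : ∀ z, q z ≠ 0 → |(q z).arg| ≤ α * π / 2 → q z ∈ slitPlane := by
    intro z hz hz'
    refine mem_slitPlane_iff_arg.2 ⟨?_, hz⟩
    have := (abs_le.1 hz').2
    nlinarith
  have habs : |(q z₀).arg| ≤ α * π / 2 := by
    rw [harg, abs_mul, abs_of_pos (by positivity : 0 < α * π / 2)]
    rcases hε with rfl | rfl <;> simp
  set a : ℝ := Real.exp (Real.log ‖q z₀‖ / α) with ha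
  have hapos : 0 < a := Real.exp_pos _
  have hPz : Complex.exp (Complex.log (q z₀) / α) = ((ε * a : ℝ) : ℂ) * I := by
    have : Complex.log (q z₀) / α = ((Real.log ‖q z₀‖ / α : ℝ) : ℂ) + (ε * (π / 2) : ℝ) * I := by
      rw [Complex.log, harg]
      push_cast
      have : (α : ℂ) ≠ 0 := by exact_mod_cast hα.ne'
      field_simp
    rw [this, Complex.exp_add, ← Complex.ofReal_exp, ← ha]
    rcases hε with rfl | rfl
    · simp [Complex.exp_pi_div_two_mul_I]
    · simp [Complex.exp_neg, Complex.exp_pi_div_two_mul_I]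
  have hdP : HasDerivAt (fun z => Complex.exp (Complex.log (q z) / α)) _ z₀ :=
    ((hd₀.clog (hslit z₀ hne habs)).div_const (α : ℂ)).cexp
  have hre : ∀ z ∈ Metric.ball (0 : ℂ) r, 0 < (Complex.exp (Complex.log (q z) / α)).re := by
    intro z hz
    have h1 := abs_lt.1 (hq z hz).2
    have him : (Complex.log (q z) / α).im = (q z).arg / α := by
      rw [Complex.div_ofReal_im, Complex.log_im]
    rw [Complex.exp_re, him]
    refine mul_pos (Real.exp_pos _) (Real.cos_pos_of_mem_Ioo ⟨?_, ?_⟩)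
    · rw [lt_div_iff₀ hα]; linarith
    · rw [div_lt_iff₀ hα]; linarith
  obtain ⟨t, ht, hteq⟩ := jack_lemma_halfPlane hr
    (((hd.clog fun z hz => hslit z (hq z hz).1 (hq z hz).2.le).div_const (α : ℂ)).cexp) hre
    (by simp [h0]) hz₀ hdP hPz
  refine ⟨t * α / a, ?_, ?_⟩
  · have hε2 : ε ^ 2 = 1 := by rcases hε with rfl | rfl <;> norm_num
    rw [mul_pow, hε2] at ht
    rw [le_div_iff₀ hapos]
    have : a ≤ t := by nlinarith [sq_nonneg (a - 1)]
    nlinarith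
  · rw [hPz] at hteq
    have hε2 : (ε : ℂ) ^ 2 = 1 := by rcases hε with rfl | rfl <;> norm_num
    have hα' : (α : ℂ) ≠ 0 := by exact_mod_cast hα.ne'
    have ha' : (a : ℂ) ≠ 0 := by exact_mod_cast hapos.ne'
    push_cast at hteq ⊢
    field_simp at hteq ⊢
    linear_combination (-ε * I) * hteq - z₀ * q' * a * hε2 + ε ^ 2 * z₀ * q' * a * I_sq

theorem Complex.arg_one_add_mul_I (x : ℝ) : (1 + x * I : ℂ).arg = Real.arctan x := by
  have h : |(1 + x * I : ℂ).arg| < π / 2 := Complex.abs_arg_lt_pi_div_two_iff.2 (Or.inl (by simp))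
  rw [← Real.arctan_tan (abs_lt.1 h).1 (abs_lt.1 h).2, Complex.tan_arg]
  simp

theorem add_arctan_le_abs_arg_mul {Q : ℂ} {α ε κ : ℝ} (hα : 0 < α) (hα1 : α ≤ 1)
    (hε : ε = 1 ∨ ε = -1) (hQ : Q ≠ 0) (harg : Q.arg = ε * (α * π / 2)) (hκ : α ≤ κ) :
    α * π / 2 + Real.arctan α ≤ |(Q * (1 + (ε * κ : ℝ) * I)).arg| := by
  have hπ := Real.pi_pos
  have hne : (1 + (ε * κ : ℝ) * I : ℂ) ≠ 0 := fun h => by simpa using congrArg Complex.re h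
  have harctan : Real.arctan (ε * κ) = ε * Real.arctan κ := by
    rcases hε with rfl | rfl <;> simp [Real.arctan_neg]
  have hsum : Q.arg + (1 + (ε * κ : ℝ) * I : ℂ).arg = ε * (α * π / 2 + Real.arctan κ) := by
    rw [Complex.arg_one_add_mul_I, harctan, harg]
    ring
  have hle : Real.arctan α ≤ Real.arctan κ := Real.arctan_mono hκ
  have h0 : 0 < Real.arctan α := Real.arctan_pos.2 hα
  have h1 : α * π / 2 + Real.arctan κ < π := by nlinarith [Real.arctan_lt_pi_div_two κ]
  have h2 : 0 < α * π / 2 := by positivity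
  rw [Complex.arg_mul hQ hne, hsum, abs_mul]
  · rw [abs_of_pos (a := α * π / 2 + Real.arctan κ) (by linarith)]
    rcases hε with rfl | rfl <;> simp [hle]
  · rw [hsum]
    rcases hε with rfl | rfl <;> constructor <;> linarith

/-- If `q` has nonnegative real part on a disc and vanishes at a boundary point, the outward derivative
there lies within angle `π / 4` of the negative real axis. -/
theorem abs_im_le_neg_re_of_boundary_zero {q : ℂ → ℂ} {q' z₀ : ℂ} {r : ℝ} (hr : 0 < r)
    (hq : ∀ z ∈ Metric.ball (0 : ℂ) r, 0 ≤ (q z).re) (hz₀ : ‖z₀‖ = r) (hd₀ : HasDerivAt q q' z₀)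
    (h0 : q z₀ = 0) : |(z₀ * q').im| ≤ -(z₀ * q').re := by
  have key : ∀ t : ℝ, (z₀ * q').re + t * (z₀ * q').im ≤ 0 := by
    intro t
    have h1 := (Complex.reCLM.hasFDerivAt.comp_hasDerivAt (0 : ℝ) (hd₀.along_ray (-1 + t * I))).neg
    have h2 := h1.nonpos_of_eventually_nonpos (by simp [h0]) ?_
    · rw [Complex.reCLM_apply, Complex.mul_re] at h2
      simp only [Complex.add_re, Complex.add_im, Complex.neg_re, Complex.neg_im, Complex.one_re,
        Complex.one_im, Complex.re_ofReal_mul, Complex.im_ofReal_mul, Complex.I_re,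
        Complex.I_im] at h2
      linarith
    · filter_upwards [eventually_mul_one_add_sq_lt_two t] with s hs
      have hmem : z₀ * (1 + s * (-1 + t * I)) ∈ Metric.ball (0 : ℂ) r := by
        rw [mem_ball_zero_iff, norm_mul, hz₀]
        nlinarith [norm_one_add_mul_lt_one hs.1 hs.2]
      simpa using hq _ hmem
  rw [abs_le]
  constructor <;> linarith [key 1, key (-1)]

theorem three_pi_div_four_le_abs_arg {w : ℂ} (hw : w ≠ 0) (h : |w.im| ≤ -w.re) :
    3 * π / 4 ≤ |w.arg| := by
  have hπ := Real.pi_pos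
  by_contra! hlt
  have hn : 0 < ‖w‖ := norm_pos_iff.2 hw
  have hcos : Real.cos (3 * π / 4) < Real.cos |w.arg| :=
    Real.cos_lt_cos_of_nonneg_of_le_pi (abs_nonneg _) (by linarith) hlt
  have h34 : Real.cos (3 * π / 4) = -(√2 / 2) := by
    rw [show 3 * π / 4 = π - π / 4 by ring, Real.cos_pi_sub, Real.cos_pi_div_four]
  rw [h34, Real.cos_abs, Complex.cos_arg hw, lt_div_iff₀ hn] at hcos
  have hre : 0 ≤ -w.re := (abs_nonneg _).trans h
  have hsq : ‖w‖ ^ 2 = w.re ^ 2 + w.im ^ 2 := by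
    rw [← Complex.normSq_eq_norm_sq, Complex.normSq_apply]; ring
  have him : w.im ^ 2 ≤ w.re ^ 2 := sq_le_sq.2 (by rwa [abs_of_nonpos (a := w.re) (by linarith)])
  have h2 : (√2) ^ 2 = 2 := Real.sq_sqrt (by norm_num)
  have hlt' : -w.re < √2 / 2 * ‖w‖ := by linarith
  have : (-w.re) ^ 2 < (√2 / 2 * ‖w‖) ^ 2 := pow_lt_pow_left₀ hlt' hre (by norm_num)
  rw [mul_pow, div_pow, h2, hsq] at this
  linarith

/-- A holomorphic function that omits the negative real axis and is not identically zero has no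
zeros. -/
theorem ne_zero_of_abs_arg_lt {g : ℂ → ℂ} {U : Set ℂ} {z₀ w : ℂ} (hg : AnalyticOnNhd ℂ g U)
    (hU : IsOpen U) (hUc : IsPreconnected U) (harg : ∀ z ∈ U, |(g z).arg| < π)
    (hw : w ∈ U) (hgw : g w ≠ 0) (hz₀ : z₀ ∈ U) : g z₀ ≠ 0 := by
  intro h0
  rcases (hg z₀ hz₀).eventually_constant_or_nhds_le_map_nhds with h | h
  · have := hg.eqOn_of_preconnected_of_eventuallyEq (analyticOnNhd_const (v := g z₀)) hUc hz₀ h hw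
    exact hgw (this.trans h0)
  · have h1 : g '' U ∈ 𝓝 (0 : ℂ) := h0 ▸ h (image_mem_map (hU.mem_nhds hz₀))
    obtain ⟨δ, hδ, hsub⟩ := Metric.mem_nhds_iff.1 h1
    obtain ⟨z, hz, hgz⟩ := hsub (show ((-(δ / 2) : ℝ) : ℂ) ∈ Metric.ball 0 δ by
      rw [mem_ball_zero_iff, Complex.norm_real, Real.norm_eq_abs, abs_neg, abs_of_pos] <;> linarith)
    have := harg z hz
    rw [hgz, Complex.arg_ofReal_of_neg (by linarith), abs_of_pos Real.pi_pos] at this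
    exact lt_irrefl _ this

theorem abs_arg_dslope_lt {h : ℂ → ℂ} {α : ℝ} (hα : 0 < α) (hα1 : α ≤ 1)
    (hh : AnalyticOnNhd ℂ h (Metric.ball 0 1)) (h0 : h 0 = 0) (h1 : deriv h 0 = 1)
    (harg : ∀ z ∈ Metric.ball (0 : ℂ) 1, |(deriv h z).arg| < α * π / 2 + Real.arctan α) :
    ∀ z ∈ Metric.ball (0 : ℂ) 1, dslope h 0 z ≠ 0 ∧ |(dslope h 0 z).arg| < α * π / 2 := by
  have hπ := Real.pi_pos
  set q := dslope h 0 with hq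
  set S : Set ℂ := {w | w ≠ 0 ∧ |w.arg| < α * π / 2} with hS
  have hαπ : α * π / 2 ≤ π / 2 := by nlinarith
  have hball : IsOpen (Metric.ball (0 : ℂ) 1) := Metric.isOpen_ball
  have hqd : DifferentiableOn ℂ q (Metric.ball 0 1) :=
    (Complex.differentiableOn_dslope (Metric.ball_mem_nhds 0 one_pos)).2 hh.differentiableOn
  have hq0 : q 0 = 1 := by rw [hq, dslope_same, h1]
  have hhq : ∀ z, h z = z * q z := by
    intro z
    have := sub_smul_dslope h 0 z
    simpa [h0] using this.symm
  have hderiv : ∀ z ∈ Metric.ball (0 : ℂ) 1, HasDerivAt q (deriv q z) z := fun z hz =>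
    (hqd.differentiableAt (hball.mem_nhds hz)).hasDerivAt
  have hdh : ∀ z ∈ Metric.ball (0 : ℂ) 1, deriv h z = q z + z * deriv q z := by
    intro z hz
    rw [show h = fun z => z * q z from funext hhq]
    simpa using ((hasDerivAt_id' z).fun_mul (hderiv z hz)).deriv
  have hbound : α * π / 2 + Real.arctan α ≤ 3 * π / 4 := by
    have : Real.arctan α ≤ π / 4 := Real.arctan_one ▸ Real.arctan_mono hα1
    linarith
  have hSopen : IsOpen S := by
    have : S = {w | w ∈ slitPlane ∧ w.arg ∈ Set.Ioo (-(α * π / 2)) (α * π / 2)} := by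
      ext w
      simp only [hS, Set.mem_ofPred_eq, abs_lt, Set.mem_Ioo]
      refine ⟨fun hw => ⟨mem_slitPlane_iff_arg.2 ⟨by linarith [hw.2.2], hw.1⟩, hw.2⟩,
        fun hw => ⟨slitPlane_ne_zero hw.1, hw.2⟩⟩
    rw [this]
    exact ContinuousOn.isOpen_inter_preimage
      (fun w hw => (Complex.continuousAt_arg hw).continuousWithinAt) isOpen_slitPlane isOpen_Ioo
  by_contra! hcon
  obtain ⟨z₁, hz₁, hz₁S⟩ := hcon
  have hsub : Metric.closedBall (0 : ℂ) ‖z₁‖ ⊆ Metric.ball 0 1 :=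
    Metric.closedBall_subset_ball (mem_ball_zero_iff.1 hz₁)
  have hK : IsCompact (Metric.closedBall (0 : ℂ) ‖z₁‖ ∩ q ⁻¹' Sᶜ) :=
    (isCompact_closedBall (0 : ℂ) ‖z₁‖).of_isClosed_subset
      ((hqd.continuousOn.mono hsub).preimage_isClosed_of_isClosed Metric.isClosed_closedBall
        hSopen.isClosed_compl) Set.inter_subset_left
  obtain ⟨z₀, ⟨hz₀c, hz₀S⟩, hmin⟩ := hK.exists_isMinOn
    ⟨z₁, by simp, fun hw => absurd (hz₁S hw.1) (not_le.2 hw.2)⟩ continuous_norm.continuousOn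
  have hz₀b : z₀ ∈ Metric.ball (0 : ℂ) 1 := hsub hz₀c
  have hinS : ∀ z ∈ Metric.ball (0 : ℂ) ‖z₀‖, q z ∈ S := by
    intro z hz
    rw [mem_ball_zero_iff] at hz
    by_contra hzS
    exact absurd (hmin ⟨mem_closedBall_zero_iff.2
      (hz.le.trans (mem_closedBall_zero_iff.1 hz₀c)), hzS⟩) (not_le.2 hz)
  have hr : 0 < ‖z₀‖ := by
    rw [norm_pos_iff]
    rintro rfl
    exact hz₀S (by simp only [hS, Set.mem_ofPred_eq, hq0]; simp; positivity)
  have hre : ∀ z ∈ Metric.ball (0 : ℂ) ‖z₀‖, 0 < (q z).re := by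
    intro z hz
    obtain ⟨ha, hb⟩ := hinS z hz
    exact (Complex.abs_arg_lt_pi_div_two_iff.1 (hb.trans_le hαπ)).resolve_right ha
  have hcl : z₀ ∈ closure (Metric.ball (0 : ℂ) ‖z₀‖) := by
    rw [closure_ball _ hr.ne']; simp
  have hne' : (𝓝[Metric.ball (0 : ℂ) ‖z₀‖] z₀).NeBot := mem_closure_iff_nhdsWithin_neBot.1 hcl
  have hqc : ContinuousAt q z₀ := (hderiv z₀ hz₀b).continuousAt
  by_cases hqz : q z₀ = 0
  · have hdne : deriv h z₀ ≠ 0 :=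
      ne_zero_of_abs_arg_lt hh.deriv hball (convex_ball (0 : ℂ) 1).isPreconnected
        (fun z hz => (harg z hz).trans_le (by linarith)) (Metric.mem_ball_self one_pos)
        (by rw [h1]; exact one_ne_zero) hz₀b
    have hle := abs_im_le_neg_re_of_boundary_zero hr (fun z hz => (hre z hz).le) rfl
      (hderiv z₀ hz₀b) hqz
    rw [← zero_add (z₀ * deriv q z₀), ← hqz, ← hdh z₀ hz₀b] at hle
    linarith [three_pi_div_four_le_abs_arg hdne hle, harg z₀ hz₀b]
  · have hre₀ : 0 ≤ (q z₀).re := by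
      refine ge_of_tendsto ((Complex.continuous_re.continuousAt.comp hqc).tendsto.mono_left
        (nhdsWithin_le_nhds (s := Metric.ball (0 : ℂ) ‖z₀‖))) ?_
      filter_upwards [self_mem_nhdsWithin] with z hz using (hre z hz).le
    have hslit : q z₀ ∈ slitPlane := by
      rw [mem_slitPlane_iff]
      by_contra! hc
      exact hqz (Complex.ext (le_antisymm hc.1 hre₀) hc.2)
    have hle : |(q z₀).arg| ≤ α * π / 2 := by
      refine le_of_tendsto ((((Complex.continuousAt_arg hslit).comp hqc).abs).tendsto.mono_left
        (nhdsWithin_le_nhds (s := Metric.ball (0 : ℂ) ‖z₀‖))) ?_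
      filter_upwards [self_mem_nhdsWithin] with z hz using (hinS z hz).2.le
    have heq : |(q z₀).arg| = α * π / 2 :=
      le_antisymm hle (not_lt.1 fun hlt => hz₀S ⟨hqz, hlt⟩)
    obtain ⟨ε, hε, hargε⟩ : ∃ ε : ℝ, (ε = 1 ∨ ε = -1) ∧ (q z₀).arg = ε * (α * π / 2) := by
      rcases eq_or_eq_neg_of_abs_eq heq with h | h
      · exact ⟨1, Or.inl rfl, by rw [h, one_mul]⟩
      · exact ⟨-1, Or.inr rfl, by rw [h, neg_one_mul]⟩
    obtain ⟨κ, hκ, hκeq⟩ := nunokawa_lemma hr hα hα1 hε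
      (hqd.mono (Metric.ball_subset_ball (mem_ball_zero_iff.1 hz₀b).le)) hinS hq0 rfl
      (hderiv z₀ hz₀b) hqz hargε
    have hfin := add_arctan_le_abs_arg_mul hα hα1 hε hqz hargε hκ
    have hdz := harg z₀ hz₀b
    rw [hdh z₀ hz₀b, hκeq, ← mul_one_add] at hdz
    linarith

/-- If `f(z) = z^p + ⋯` is analytic in the unit disc and
`|arg f^{(p)}(z)| < (π/2)(α₁ + (2/π)·arctan α₁)` on the disc for some `α₁ ∈ (0,1]`,
then `|arg(f^{(p-1)}(z)/z)| < α₁π/2` on the punctured disc. -/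
theorem stmt_0 (p : ℕ) (hp : 1 ≤ p) (f : ℂ → ℂ)
    (hf : AnalyticOnNhd ℂ f {z : ℂ | ‖z‖ < 1})
    (hf0 : ∀ k < p, iteratedDeriv k f 0 = 0)
    (hfp : iteratedDeriv p f 0 = (p.factorial : ℂ))
    (α₁ : ℝ) (hα₁ : α₁ ∈ Set.Ioc (0 : ℝ) 1)
    (harg : ∀ z : ℂ, ‖z‖ < 1 →
      |Complex.arg (iteratedDeriv p f z)| <
        (Real.pi / 2) * (α₁ + (2 / Real.pi) * Real.arctan α₁)) :
    ∀ z : ℂ, ‖z‖ < 1 → z ≠ 0 →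
      |Complex.arg (iteratedDeriv (p - 1) f z / z)| < α₁ * Real.pi / 2 := by
  intro z hz hz0
  obtain ⟨n, rfl⟩ : ∃ n, p = n + 1 := ⟨p - 1, by omega⟩
  rw [Nat.add_sub_cancel]
  set c : ℝ := (((n + 1).factorial : ℝ))⁻¹ with hc
  have hcpos : 0 < c := by positivity
  have hderiv : ∀ w, deriv (fun z => (c : ℂ) * iteratedDeriv n f z) w =
      c * iteratedDeriv (n + 1) f w := by
    intro w
    rw [deriv_const_mul_field, iteratedDeriv_succ]
  have hset : {z : ℂ | ‖z‖ < 1} = Metric.ball 0 1 := by ext; simp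
  have hana : AnalyticOnNhd ℂ (fun z => (c : ℂ) * iteratedDeriv n f z) (Metric.ball 0 1) := by
    rw [iteratedDeriv_eq_iterate, ← hset]
    exact analyticOnNhd_const.mul (hf.iterated_deriv n)
  have hbound : (π / 2) * (α₁ + (2 / π) * Real.arctan α₁) = α₁ * π / 2 + Real.arctan α₁ := by
    field_simp
  have hmain := (abs_arg_dslope_lt hα₁.1 hα₁.2 hana (by simp [hf0 n n.lt_succ_self])
    (by rw [hderiv, hfp, hc, Complex.ofReal_inv, Complex.ofReal_natCast,
      inv_mul_cancel₀ (Nat.cast_ne_zero.2 (Nat.factorial_ne_zero _))]) (fun w hw => by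
      rw [hderiv, Complex.arg_real_mul _ hcpos, ← hbound]
      exact harg w (mem_ball_zero_iff.1 hw)) z (mem_ball_zero_iff.2 hz)).2
  rw [dslope_of_ne _ hz0, slope_def_field, hf0 n n.lt_succ_self, mul_zero, sub_zero, sub_zero,
    mul_div_assoc, Complex.arg_real_mul _ hcpos] at hmain
  exact hmain
end

section
/- Let p ≥ 1 be an integer and let f(z) = z^p + ∑_{n=p+1}^∞ a_n z^n be analytic in the open unit disc 𝔻. If |arg f^{(p)}(z)| < 3π/4 for all z ∈ 𝔻, then |arg( f^{(p-1)}(z)/z )| < π/2 for all z ∈ 𝔻, z ≠ 0; equivalently Re( f^{(p-1)}(z)/z ) > 0 on 𝔻 \ {0}. -/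
open Complex Real

/-- Boundary Schwarz estimate: a function with positive real part on the disc of radius `‖z₀‖`,
equal to `1` at the origin and with vanishing real part at `z₀`, has
`z₀ q'(z₀)` real and at most `-(1 + (Im q(z₀))²) / 2`. -/
lemma mul_deriv_of_re_pos_of_re_eq_zero {q : ℂ → ℂ} {z₀ q' : ℂ} (hz₀ : z₀ ≠ 0)
    (hq : DifferentiableOn ℂ q (Metric.ball 0 ‖z₀‖)) (hq0 : q 0 = 1)
    (hpos : ∀ z, ‖z‖ < ‖z₀‖ → 0 < (q z).re) (hnonneg : ∀ z, ‖z‖ = ‖z₀‖ → 0 ≤ (q z).re)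
    (hre : (q z₀).re = 0) (hd : HasDerivAt q q' z₀) :
    (z₀ * q').im = 0 ∧ (z₀ * q').re ≤ -(1 + (q z₀).im ^ 2) / 2 := by
  have him : (z₀ * q').im = 0 := by
    have h1 : HasDerivAt (fun θ : ℝ => z₀ * exp (θ * I)) (z₀ * I) 0 := by
      have h : HasDerivAt (fun θ : ℝ => (θ : ℂ) * I) I 0 := by
        simpa using (HasDerivAt.ofReal_comp (hasDerivAt_id (0 : ℝ))).mul_const I
      simpa using (h.cexp.const_mul z₀)
    have h2 : HasDerivAt (fun θ : ℝ => (q (z₀ * exp (θ * I))).re) (q' * (z₀ * I)).re 0 := by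
      have hd' : HasDerivAt q q' (z₀ * exp (((0 : ℝ) : ℂ) * I)) := by simpa using hd
      exact reCLM.hasFDerivAt.comp_hasDerivAt (0 : ℝ)
        (HasDerivAt.comp (0 : ℝ) hd' h1)
    have h3 : IsLocalMin (fun θ : ℝ => (q (z₀ * exp (θ * I))).re) 0 := by
      refine Filter.Eventually.of_forall fun θ => ?_
      simpa [hre] using hnonneg (z₀ * exp (θ * I)) (by simp [norm_exp_ofReal_mul_I])
    have h4 := h3.hasDerivAt_eq_zero h2
    simp at h4 ⊢
    linarith
  refine ⟨him, ?_⟩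
  have hne : ∀ z, ‖z‖ < ‖z₀‖ → 1 + q z ≠ 0 := fun z hz h => by
    have := congrArg re h
    simp at this
    linarith [hpos z hz]
  have hschwarz : ∀ z, ‖z‖ < ‖z₀‖ → ‖(1 - q z) / (1 + q z)‖ ≤ 1 / ‖z₀‖ * ‖z‖ := by
    intro z hz
    have hw : DifferentiableOn ℂ (fun z => (1 - q z) / (1 + q z)) (Metric.ball 0 ‖z₀‖) :=
      (hq.const_sub 1).div (hq.const_add 1) fun z hz => hne z (by simpa using hz)
    have hmaps : Set.MapsTo (fun z => (1 - q z) / (1 + q z)) (Metric.ball 0 ‖z₀‖)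
        (Metric.ball ((1 - q 0) / (1 + q 0)) 1) := by
      intro z hz
      have hz' : ‖z‖ < ‖z₀‖ := by simpa using hz
      have hp := hpos z hz'
      simp only [hq0, sub_self, zero_div, mem_ball_zero_iff, norm_div]
      rw [div_lt_one (norm_pos_iff.2 (hne z hz')), ← sq_lt_sq₀ (norm_nonneg _) (norm_nonneg _),
        ← normSq_eq_norm_sq, ← normSq_eq_norm_sq, normSq_apply, normSq_apply]
      simp
      nlinarith
    have := dist_le_div_mul_dist_of_mapsTo_ball hw
      (hmaps.mono_right Metric.ball_subset_closedBall) (z := z) (by simpa using hz)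
    simpa [hq0] using this
  set a := (q z₀).im with ha
  let φ : ℝ → ℝ := fun t => (1 - (q (t * z₀)).re) ^ 2 + (q (t * z₀)).im ^ 2
    - t ^ 2 * ((1 + (q (t * z₀)).re) ^ 2 + (q (t * z₀)).im ^ 2)
  have hφ1 : φ 1 = 0 := by simp [φ, hre]
  have hφ : ∀ t ∈ Set.Ioo (0 : ℝ) 1, φ t ≤ 0 := by
    intro t ht
    have hn : ‖(t : ℂ) * z₀‖ = t * ‖z₀‖ := by simp [abs_of_pos ht.1]
    have hz₀' : 0 < ‖z₀‖ := norm_pos_iff.2 hz₀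
    have hlt : ‖(t : ℂ) * z₀‖ < ‖z₀‖ := by rw [hn]; nlinarith [ht.2]
    have h := hschwarz _ hlt
    rw [hn, norm_div, div_le_iff₀ (norm_pos_iff.2 (hne _ hlt))] at h
    have e : 1 / ‖z₀‖ * (t * ‖z₀‖) = t := by field_simp
    rw [e] at h
    have h2 := pow_le_pow_left₀ (norm_nonneg _) h 2
    rw [mul_pow, ← normSq_eq_norm_sq, ← normSq_eq_norm_sq, normSq_apply, normSq_apply] at h2
    simp only [sub_re, one_re, sub_im, one_im, add_re, add_im] at h2
    simp only [φ]
    nlinarith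
  have hcurve : HasDerivAt (fun t : ℝ => q (t * z₀)) (q' * z₀) 1 := by
    have h1 : HasDerivAt (fun t : ℝ => (t : ℂ) * z₀) z₀ 1 := by
      simpa using (HasDerivAt.ofReal_comp (hasDerivAt_id (1 : ℝ))).mul_const z₀
    have hd' : HasDerivAt q q' (((1 : ℝ) : ℂ) * z₀) := by simpa using hd
    exact HasDerivAt.comp (1 : ℝ) hd' h1
  have hu : HasDerivAt (fun t : ℝ => (q (t * z₀)).re) (z₀ * q').re 1 := by
    rw [mul_comm]; exact reCLM.hasFDerivAt.comp_hasDerivAt (1 : ℝ) hcurve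
  have hv : HasDerivAt (fun t : ℝ => (q (t * z₀)).im) 0 1 := by
    rw [← him, mul_comm]; exact imCLM.hasFDerivAt.comp_hasDerivAt (1 : ℝ) hcurve
  have hφd : HasDerivAt φ (-4 * (z₀ * q').re - 2 * (1 + a ^ 2)) 1 := by
    have h := (((hu.const_sub 1).pow 2).add (hv.pow 2)).sub
      (((hasDerivAt_id (1 : ℝ)).pow 2).mul (((hu.const_add 1).pow 2).add (hv.pow 2)))
    refine h.congr_deriv ?_
    simp [hre, ← ha]
    ring
  have hnn : 0 ≤ -4 * (z₀ * q').re - 2 * (1 + a ^ 2) := by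
    have hslope := hasDerivWithinAt_iff_tendsto_slope.1 (hφd.hasDerivWithinAt (s := Set.Iio 1))
    rw [show Set.Iio (1 : ℝ) \ {1} = Set.Iio 1 by simp] at hslope
    refine ge_of_tendsto hslope ?_
    filter_upwards [Ioo_mem_nhdsLT (zero_lt_one' ℝ)] with t ht
    rw [slope_def_field, hφ1]
    exact div_nonneg_of_nonpos (by linarith [hφ t ht]) (by linarith [ht.2])
  linarith

/-- If `g(0) = 0`, `g'(0) = 1` and `g'` omits the sector `|Im w| ≤ -Re w`, `w ≠ 0`, on the unit
disc, then the real part of `g(z)/z` is positive there. -/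
lemma re_dslope_pos_of_deriv_omits_sector {g : ℂ → ℂ}
    (hg : DifferentiableOn ℂ g (Metric.ball 0 1)) (hg0 : g 0 = 0) (hg1 : deriv g 0 = 1)
    (hsector : ∀ z, ‖z‖ < 1 → (deriv g z).re < 0 → -(deriv g z).re < |(deriv g z).im|)
    {z : ℂ} (hz : ‖z‖ < 1) : 0 < (dslope g 0 z).re := by
  by_contra! hcon
  set q := dslope g 0 with hqdef
  have hball : Metric.ball (0 : ℂ) 1 ∈ nhds 0 := Metric.ball_mem_nhds _ one_pos
  have hq : DifferentiableOn ℂ q (Metric.ball 0 1) := (differentiableOn_dslope hball).2 hg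
  have hq0 : q 0 = 1 := by simp [hqdef, hg1]
  have hgq : ∀ w, g w = w * q w := fun w => by
    have := sub_smul_dslope g 0 w
    simpa [hg0] using this.symm
  have hsub : Metric.closedBall (0 : ℂ) ‖z‖ ⊆ Metric.ball 0 1 := Metric.closedBall_subset_ball hz
  obtain ⟨z₀, ⟨hz₀z, hz₀re⟩, hmin⟩ :
      ∃ z₀ ∈ Metric.closedBall (0 : ℂ) ‖z‖ ∩ (fun w => (q w).re) ⁻¹' Set.Iic 0,
        IsMinOn norm (Metric.closedBall (0 : ℂ) ‖z‖ ∩ (fun w => (q w).re) ⁻¹' Set.Iic 0) z₀ := by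
    refine IsCompact.exists_isMinOn ?_ ?_ continuous_norm.continuousOn
    swap
    · exact ⟨z, by simp, hcon⟩
    refine (isCompact_closedBall (0 : ℂ) ‖z‖).of_isClosed_subset ?_ Set.inter_subset_left
    exact (continuous_re.comp_continuousOn (hq.continuousOn.mono hsub)).preimage_isClosed_of_isClosed
      Metric.isClosed_closedBall isClosed_Iic
  have hz₀z' : ‖z₀‖ ≤ ‖z‖ := by simpa using hz₀z
  have hz₀1 : ‖z₀‖ < 1 := hz₀z'.trans_lt hz
  have hz₀ : z₀ ≠ 0 := by
    rintro rfl
    simp [hq0] at hz₀re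
    linarith
  have hpos : ∀ w, ‖w‖ < ‖z₀‖ → 0 < (q w).re := by
    intro w hw
    by_contra! h
    have : ‖z₀‖ ≤ ‖w‖ := isMinOn_iff.1 hmin w ⟨by simpa using hw.le.trans hz₀z', h⟩
    linarith
  have hnonneg : ∀ w, ‖w‖ = ‖z₀‖ → 0 ≤ (q w).re := by
    intro w hw
    have hwcl : w ∈ closure (Metric.ball (0 : ℂ) ‖z₀‖) := by
      rw [closure_ball _ (norm_ne_zero_iff.2 hz₀)]; simp [hw]
    have hcont : ContinuousWithinAt (fun w => (q w).re) (Metric.ball (0 : ℂ) ‖z₀‖) w :=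
      (continuous_re.comp_continuousOn hq.continuousOn w (by simpa [hw] using hz₀1)).mono
        (Metric.ball_subset_ball hz₀1.le)
    have := mem_closure_iff_nhdsWithin_neBot.1 hwcl
    refine ge_of_tendsto hcont ?_
    filter_upwards [self_mem_nhdsWithin] with v hv
    exact (hpos v (by simpa using hv)).le
  have hre : (q z₀).re = 0 := le_antisymm hz₀re (hnonneg z₀ rfl)
  have hd : HasDerivAt q (deriv q z₀) z₀ :=
    (hq.differentiableAt (Metric.isOpen_ball.mem_nhds (by simpa using hz₀1))).hasDerivAt
  obtain ⟨him, hle⟩ := mul_deriv_of_re_pos_of_re_eq_zero hz₀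
    (hq.mono (Metric.ball_subset_ball hz₀1.le)) hq0 hpos hnonneg hre hd
  have hderiv : deriv g z₀ = q z₀ + z₀ * deriv q z₀ := by
    have h := (hasDerivAt_id z₀).mul hd
    rw [show g = id * q from funext hgq, h.deriv]
    simp
  have h1 : (deriv g z₀).re = (z₀ * deriv q z₀).re := by rw [hderiv, add_re, hre, zero_add]
  have h2 : (deriv g z₀).im = (q z₀).im := by rw [hderiv, add_im, him, add_zero]
  have h3 := hsector z₀ hz₀1 (by rw [h1]; nlinarith [sq_nonneg (q z₀).im])
  rw [h1, h2] at h3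
  nlinarith [sq_nonneg (|(q z₀).im| - 1), sq_abs (q z₀).im]

lemma neg_re_lt_abs_im_of_abs_arg_lt {w : ℂ} (h : |arg w| < 3 * π / 4) (hw : w.re < 0) :
    -w.re < |w.im| := by
  have hcos : Real.cos (3 * π / 4) < Real.cos (arg w) := by
    rw [← Real.cos_abs (arg w)]
    exact Real.cos_lt_cos_of_nonneg_of_le_pi (abs_nonneg _) (by linarith [Real.pi_pos]) h
  have h34 : Real.cos (3 * π / 4) = -(√2 / 2) := by
    rw [show 3 * π / 4 = π - π / 4 by ring, Real.cos_pi_sub, Real.cos_pi_div_four]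
  have hw0 : w ≠ 0 := by rintro rfl; simp at hw
  have hn : 0 < ‖w‖ := norm_pos_iff.2 hw0
  have hmul := mul_lt_mul_of_pos_left hcos hn
  rw [norm_mul_cos_arg, h34] at hmul
  have hsq : ‖w‖ ^ 2 = w.re * w.re + w.im * w.im := by rw [← normSq_eq_norm_sq, normSq_apply]
  have h2 : (-w.re) ^ 2 < (‖w‖ * (√2 / 2)) ^ 2 :=
    pow_lt_pow_left₀ (by linarith) (by linarith) two_ne_zero
  rw [mul_pow, div_pow, Real.sq_sqrt zero_le_two, hsq] at h2
  refine lt_of_pow_lt_pow_left₀ 2 (abs_nonneg _) ?_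
  rw [sq_abs]
  nlinarith

/-- If `f(z) = z^p + ⋯` is analytic in the unit disc and
`|arg f^{(p)}(z)| < 3π/4` on the disc, then `|arg(f^{(p-1)}(z)/z)| < π/2`,
equivalently `Re(f^{(p-1)}(z)/z) > 0`, on the punctured disc. -/
theorem stmt_1 (p : ℕ) (hp : 1 ≤ p) (f : ℂ → ℂ)
    (hf : AnalyticOnNhd ℂ f {z : ℂ | ‖z‖ < 1})
    (hf0 : ∀ k < p, iteratedDeriv k f 0 = 0)
    (hfp : iteratedDeriv p f 0 = (p.factorial : ℂ))
    (harg : ∀ z : ℂ, ‖z‖ < 1 →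
      |Complex.arg (iteratedDeriv p f z)| < 3 * Real.pi / 4) :
    ∀ z : ℂ, ‖z‖ < 1 → z ≠ 0 →
      |Complex.arg (iteratedDeriv (p - 1) f z / z)| < Real.pi / 2 ∧
        0 < (iteratedDeriv (p - 1) f z / z).re := by
  obtain ⟨n, rfl⟩ : ∃ n, p = n + 1 := ⟨p - 1, by omega⟩
  simp only [Nat.add_sub_cancel]
  set c : ℝ := ((n + 1).factorial : ℝ) with hc
  have hc0 : 0 < c := by positivity
  have hcC : (c : ℂ) ≠ 0 := ofReal_ne_zero.2 hc0.ne'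
  set G := iteratedDeriv n f with hG
  have hset : {z : ℂ | ‖z‖ < 1} = Metric.ball 0 1 := by ext; simp
  have hGd : DifferentiableOn ℂ G (Metric.ball 0 1) := by
    rw [← hset, hG, iteratedDeriv_eq_iterate]; exact (hf.iterated_deriv n).differentiableOn
  have hG' : ∀ z, deriv (fun z => ((c⁻¹ : ℝ) : ℂ) * G z) z
      = ((c⁻¹ : ℝ) : ℂ) * iteratedDeriv (n + 1) f z := fun z => by
    rw [deriv_const_mul_field, iteratedDeriv_succ]
  have hG0 : G 0 = 0 := hf0 n (Nat.lt_succ_self n)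
  intro z hz hz0
  have hpos := re_dslope_pos_of_deriv_omits_sector (g := fun z => ((c⁻¹ : ℝ) : ℂ) * G z)
    (hGd.const_mul _) (by simp [hG0])
    (by rw [hG', hfp, ofReal_inv]; exact inv_mul_cancel₀ hcC)
    (fun w hw hneg => by
      refine neg_re_lt_abs_im_of_abs_arg_lt ?_ hneg
      rw [hG', arg_real_mul _ (inv_pos.2 hc0)]
      exact harg w hw) hz
  have hre : 0 < (G z / z).re := by
    rw [dslope_of_ne _ hz0, slope_def_field, hG0, mul_zero, sub_zero, sub_zero, mul_div_assoc,
      re_ofReal_mul] at hpos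
    exact pos_of_mul_pos_right hpos (inv_pos.2 hc0).le
  exact ⟨abs_arg_lt_pi_div_two_iff.2 (Or.inl hre), hre⟩
end

section
/- Let p ≥ 1 be an integer and let f(z) = z^p + ∑_{n=p+1}^∞ a_n z^n be analytic in the open unit disc 𝔻. If |arg f^{(p)}(z)| < 3π/4 for all z ∈ 𝔻, then for every k ∈ {0, 1, …, p-1} one has Re( f^{(p-k-1)}(z)/z^{k+1} ) > 0 for all z ∈ 𝔻, z ≠ 0. -/
open Complex Real

/-- A complex number in the closed sector `|im w| ≤ -re w`, `re w < 0`, has argument of modulus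
at least `3π/4`. -/
theorem three_pi_div_four_le_abs_arg_s2 {w : ℂ} (hre : w.re < 0) (him : |w.im| ≤ -w.re) :
    3 * Real.pi / 4 ≤ |Complex.arg w| := by
  by_contra! hlt
  have hw : w ≠ 0 := by
    rintro rfl
    simp at hre
  have hpos : 0 < ‖w‖ := norm_pos_iff.mpr hw
  have hcos : Real.cos (3 * Real.pi / 4) < Real.cos |Complex.arg w| :=
    Real.cos_lt_cos_of_nonneg_of_le_pi (abs_nonneg _) (by linarith [Real.pi_pos]) hlt
  have hval : Real.cos (3 * Real.pi / 4) = -(√2 / 2) := by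
    rw [show 3 * Real.pi / 4 = Real.pi - Real.pi / 4 by ring, Real.cos_pi_sub,
      Real.cos_pi_div_four]
  rw [hval, Real.cos_abs, Complex.cos_arg hw, lt_div_iff₀ hpos] at hcos
  have hnorm : ‖w‖ ^ 2 = w.re ^ 2 + w.im ^ 2 := by
    rw [Complex.sq_norm, Complex.normSq_apply]
    ring
  have him2 : w.im ^ 2 ≤ w.re ^ 2 := sq_le_sq.mpr (by rwa [abs_of_neg hre])
  have hlt' : -w.re < √2 / 2 * ‖w‖ := by linarith
  have hsq : (-w.re) ^ 2 < (√2 / 2 * ‖w‖) ^ 2 := by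
    gcongr
    linarith
  rw [mul_pow, div_pow, Real.sq_sqrt (by norm_num)] at hsq
  linarith

/-- A function with nonnegative values to the left of a zero has nonpositive derivative there. -/
theorem HasDerivAt.nonpos_of_nonneg_left {φ : ℝ → ℝ} {a b d : ℝ} (hab : a < b)
    (hd : HasDerivAt φ d b) (hb : φ b = 0) (hφ : ∀ t ∈ Set.Ioo a b, 0 ≤ φ t) : d ≤ 0 := by
  have hlim : Filter.Tendsto (slope φ b) (nhdsWithin b (Set.Iio b)) (nhds d) :=
    (hasDerivAt_iff_tendsto_slope.mp hd).mono_left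
      (nhdsWithin_mono _ fun _ ht => ne_of_lt ht)
  refine le_of_tendsto hlim ?_
  filter_upwards [Ioo_mem_nhdsLT hab] with t ht
  rw [slope_def_field, hb, sub_zero]
  exact div_nonpos_of_nonneg_of_nonpos (hφ t ht) (by linarith [ht.2])

/-- Let `F` be holomorphic near the closed disc of radius `‖z₀‖`, with `F 0 = c > 0`, positive real
part inside the disc and `re (F z₀) = 0`. Then `z₀ F'(z₀)` is real and
`z₀ F'(z₀) ≤ -(c² + (im F(z₀))²) / (2c)`. -/
theorem mul_deriv_of_re_eq_zero {F : ℂ → ℂ} {R c : ℝ} {z₀ : ℂ} (hc : 0 < c) (hz₀ : z₀ ≠ 0)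
    (hR : ‖z₀‖ < R) (hF : DifferentiableOn ℂ F (Metric.ball 0 R)) (hF0 : F 0 = c)
    (hpos : ∀ z, ‖z‖ < ‖z₀‖ → 0 < (F z).re) (hzero : (F z₀).re = 0) :
    (z₀ * deriv F z₀).im = 0 ∧
      c ^ 2 + (F z₀).im ^ 2 + 2 * c * (z₀ * deriv F z₀).re ≤ 0 := by
  have hr : 0 < ‖z₀‖ := norm_pos_iff.mpr hz₀
  have hdiff : ∀ z, ‖z‖ ≤ ‖z₀‖ → DifferentiableAt ℂ F z := fun z hz =>
    hF.differentiableAt (Metric.isOpen_ball.mem_nhds (by simpa using hz.trans_lt hR))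
  have hray : ∀ t ∈ Set.Ioo (0 : ℝ) 1, ∀ z : ℂ, ‖z‖ = ‖z₀‖ → ‖(t : ℂ) * z‖ < ‖z₀‖ := by
    intro t ht z hz
    rw [norm_mul, hz, Complex.norm_real, Real.norm_of_nonneg ht.1.le]
    exact mul_lt_of_lt_one_left hr ht.2
  have hcircle : ∀ z, ‖z‖ = ‖z₀‖ → 0 ≤ (F z).re := by
    intro z hz
    have hcont : ContinuousAt (fun t : ℝ => (F ((t : ℂ) * z)).re) 1 := by
      refine Complex.continuous_re.continuousAt.comp (ContinuousAt.comp (g := F) ?_ ?_)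
      · simpa using (hdiff z hz.le).continuousAt
      · fun_prop
    have hlim := hcont.tendsto.mono_left (nhdsWithin_le_nhds (s := Set.Iio 1))
    have hge := ge_of_tendsto (b := 0) hlim (by
      filter_upwards [Ioo_mem_nhdsLT (show (0 : ℝ) < 1 by norm_num)] with t ht
      exact (hpos _ (hray t ht z hz)).le)
    simpa using hge
  have htang : (z₀ * deriv F z₀).im = 0 := by
    have hrot : HasDerivAt (fun θ : ℂ => z₀ * Complex.exp (θ * I)) (z₀ * I) ((0 : ℝ) : ℂ) := by
      have := (((hasDerivAt_id ((0 : ℝ) : ℂ)).mul_const I).cexp).const_mul z₀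
      simpa using this
    have hFz : HasDerivAt F (deriv F z₀) (z₀ * Complex.exp (((0 : ℝ) : ℂ) * I)) := by
      simpa using (hdiff z₀ le_rfl).hasDerivAt
    have hd := (HasDerivAt.comp (h := fun θ : ℂ => z₀ * Complex.exp (θ * I)) ((0 : ℝ) : ℂ)
      hFz hrot).real_of_complex
    have hmin : IsLocalMin
        (fun θ : ℝ => ((F ∘ fun θ : ℂ => z₀ * Complex.exp (θ * I)) θ).re) 0 := by
      refine Filter.Eventually.of_forall fun θ => ?_
      have h0 := hcircle (z₀ * Complex.exp (θ * I)) (by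
        rw [norm_mul, Complex.norm_exp_ofReal_mul_I, mul_one])
      simpa [hzero] using h0
    have := hmin.hasDerivAt_eq_zero hd
    simp only [Complex.mul_re, Complex.mul_im, Complex.I_re, Complex.I_im] at this ⊢
    linarith
  refine ⟨htang, ?_⟩
  have hne : ∀ z, ‖z‖ < ‖z₀‖ → (c : ℂ) + F z ≠ 0 := by
    intro z hz h
    have := congrArg Complex.re h
    simp only [Complex.add_re, Complex.ofReal_re, Complex.zero_re] at this
    linarith [hpos z hz]
  have hschwarz : ∀ z, ‖z‖ < ‖z₀‖ → ‖(c - F z) / (c + F z)‖ ≤ ‖z‖ / ‖z₀‖ := by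
    intro z hz
    have hwd : DifferentiableOn ℂ (fun z => (c - F z) / (c + F z)) (Metric.ball 0 ‖z₀‖) := by
      intro x hx
      have hx' : ‖x‖ < ‖z₀‖ := by simpa using hx
      have hFx := hdiff x hx'.le
      exact ((hFx.const_sub _).div (hFx.const_add _) (hne x hx')).differentiableWithinAt
    have hmaps : Set.MapsTo (fun z => (c - F z) / (c + F z)) (Metric.ball 0 ‖z₀‖)
        (Metric.ball ((fun z => (c - F z) / (c + F z)) 0) 1) := by
      intro x hx
      have hx' : ‖x‖ < ‖z₀‖ := by simpa using hx
      have hp := hpos x hx'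
      simp only [hF0, sub_self, zero_div, mem_ball_zero_iff, norm_div]
      rw [div_lt_one (norm_pos_iff.mpr (hne x hx'))]
      refine lt_of_pow_lt_pow_left₀ 2 (norm_nonneg _) ?_
      rw [Complex.sq_norm, Complex.sq_norm, Complex.normSq_apply, Complex.normSq_apply]
      simp only [Complex.add_re, Complex.add_im, Complex.sub_re, Complex.sub_im,
        Complex.ofReal_re, Complex.ofReal_im]
      nlinarith [mul_pos hc hp]
    have := Complex.dist_le_div_mul_dist_of_mapsTo_ball hwd
      (hmaps.mono_right Metric.ball_subset_closedBall) (z := z) (by simpa using hz)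
    simp only [hF0, sub_self, zero_div, dist_zero_right] at this
    rwa [one_div_mul_eq_div] at this
  have hradial : HasDerivAt (fun t : ℂ => F (t * z₀)) (z₀ * deriv F z₀) ((1 : ℝ) : ℂ) := by
    have hFz : HasDerivAt F (deriv F z₀) (((1 : ℝ) : ℂ) * z₀) := by
      simpa using (hdiff z₀ le_rfl).hasDerivAt
    have := HasDerivAt.comp (h := fun t => t * z₀) ((1 : ℝ) : ℂ) hFz
      ((hasDerivAt_id ((1 : ℝ) : ℂ)).mul_const z₀)
    simpa [mul_comm, Function.comp_def] using this
  have hre : HasDerivAt (fun t : ℝ => (F (t * z₀)).re) (z₀ * deriv F z₀).re 1 :=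
    hradial.real_of_complex
  have him : HasDerivAt (fun t : ℝ => (F (t * z₀)).im) 0 1 := by
    have := (hradial.const_mul (-I)).real_of_complex
    simp only [Complex.mul_re, Complex.neg_re, Complex.neg_im, Complex.I_re, Complex.I_im] at this
    rw [Complex.mul_im] at htang
    simpa [htang] using this
  have hφ := (((hasDerivAt_id (1 : ℝ)).pow 2).mul
    (((hre.const_add c).pow 2).add (him.pow 2))).sub (((hre.const_sub c).pow 2).add (him.pow 2))
  have hle := hφ.nonpos_of_nonneg_left (a := 0) one_pos (by simp [hzero]) (by
    intro t ht
    have hlt := hray t ht z₀ rfl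
    have h := hschwarz _ hlt
    rw [norm_mul, Complex.norm_real, Real.norm_of_nonneg ht.1.le, mul_div_cancel_right₀ _ hr.ne',
      norm_div, div_le_iff₀ (norm_pos_iff.mpr (hne _ hlt))] at h
    have h2 := pow_le_pow_left₀ (norm_nonneg _) h 2
    rw [mul_pow, Complex.sq_norm, Complex.sq_norm, Complex.normSq_apply,
      Complex.normSq_apply] at h2
    simp only [Complex.add_re, Complex.add_im, Complex.sub_re, Complex.sub_im,
        Complex.ofReal_re, Complex.ofReal_im] at h2
    simp only [Pi.sub_apply, Pi.mul_apply, Pi.add_apply, Pi.pow_apply, id]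
    nlinarith)
  simp [hzero] at hle
  simp
  linarith

/-- If `h` is holomorphic in the unit disc, `h 0 = 0`, `h' 0 > 0` and `|arg h'| < 3π/4`, then
`re (h z / z) > 0`. -/
theorem re_div_pos_of_abs_arg_deriv_lt {h : ℂ → ℂ} {c : ℝ} (hc : 0 < c)
    (hh : DifferentiableOn ℂ h (Metric.ball 0 1)) (h0 : h 0 = 0) (hderiv : deriv h 0 = c)
    (harg : ∀ z : ℂ, ‖z‖ < 1 → |Complex.arg (deriv h z)| < 3 * Real.pi / 4)
    {z : ℂ} (hz : ‖z‖ < 1) (hz0 : z ≠ 0) : 0 < (h z / z).re := by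
  set F : ℂ → ℂ := dslope h 0 with hFdef
  have hF : DifferentiableOn ℂ F (Metric.ball 0 1) :=
    (Complex.differentiableOn_dslope (Metric.ball_mem_nhds 0 one_pos)).mpr hh
  have hF0 : F 0 = c := by rw [hFdef, dslope_same, hderiv]
  have hmul : ∀ x, x * F x = h x := by
    intro x
    simpa [h0] using sub_smul_dslope h 0 x
  have hFz : F z = h z / z := by rw [← hmul z, mul_div_cancel_left₀ _ hz0]
  rw [← hFz]
  by_contra! hneg
  have hsub : Metric.closedBall (0 : ℂ) ‖z‖ ⊆ Metric.ball 0 1 :=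
    Metric.closedBall_subset_ball hz
  have hcont : ContinuousOn (fun x => (F x).re) (Metric.closedBall 0 ‖z‖) :=
    Complex.continuous_re.comp_continuousOn (hF.continuousOn.mono hsub)
  have hcompact : IsCompact (Metric.closedBall (0 : ℂ) ‖z‖ ∩ (fun x => (F x).re) ⁻¹' Set.Iic 0) :=
    (isCompact_closedBall 0 ‖z‖).of_isClosed_subset
      (hcont.preimage_isClosed_of_isClosed Metric.isClosed_closedBall isClosed_Iic)
      Set.inter_subset_left
  obtain ⟨z₀, ⟨hz₀, hz₀neg⟩, hz₀min⟩ := hcompact.exists_isMinOn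
    ⟨z, by simp, hneg⟩ continuous_norm.continuousOn
  have hz₀le : ‖z₀‖ ≤ ‖z‖ := by simpa using hz₀
  have hz₀neg' : (F z₀).re ≤ 0 := hz₀neg
  have hpos : ∀ x, ‖x‖ < ‖z₀‖ → 0 < (F x).re := by
    intro x hx
    by_contra! hxneg
    have := hz₀min (a := x) ⟨by simpa using hx.le.trans hz₀le, hxneg⟩
    exact absurd hx (not_lt.mpr this)
  have hz₀0 : z₀ ≠ 0 := by
    rintro rfl
    rw [hF0, Complex.ofReal_re] at hz₀neg'
    linarith
  have hdiff : DifferentiableAt ℂ F z₀ :=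
    hF.differentiableAt (Metric.isOpen_ball.mem_nhds (hsub hz₀))
  have hzero : (F z₀).re = 0 := by
    refine le_antisymm hz₀neg' ?_
    have hray : ContinuousAt (fun t : ℝ => (F ((t : ℂ) * z₀)).re) 1 := by
      refine Complex.continuous_re.continuousAt.comp (ContinuousAt.comp (g := F) ?_ ?_)
      · simpa using hdiff.continuousAt
      · fun_prop
    have hlim := hray.tendsto.mono_left (nhdsWithin_le_nhds (s := Set.Iio 1))
    have hge := ge_of_tendsto (b := 0) hlim (by
      filter_upwards [Ioo_mem_nhdsLT (show (0 : ℝ) < 1 by norm_num)] with t ht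
      refine (hpos _ ?_).le
      rw [norm_mul, Complex.norm_real, Real.norm_of_nonneg ht.1.le]
      exact mul_lt_of_lt_one_left (norm_pos_iff.mpr hz₀0) ht.2)
    simpa using hge
  have hz₀lt : ‖z₀‖ < 1 := hz₀le.trans_lt hz
  obtain ⟨him, hre⟩ := mul_deriv_of_re_eq_zero hc hz₀0 hz₀lt hF hF0 hpos hzero
  have hder : deriv h z₀ = F z₀ + z₀ * deriv F z₀ := by
    have : h = fun x => x * F x := funext fun x => (hmul x).symm
    rw [this]
    simpa using ((hasDerivAt_id' z₀).fun_mul hdiff.hasDerivAt).deriv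
  refine absurd (harg z₀ hz₀lt) (not_lt.mpr (three_pi_div_four_le_abs_arg_s2 ?_ ?_))
  · rw [hder, Complex.add_re, hzero, zero_add]
    by_contra! hcon
    nlinarith [mul_nonneg hc.le hcon, sq_nonneg (F z₀).im, sq_pos_of_pos hc]
  · rw [hder, Complex.add_re, Complex.add_im, hzero, him, zero_add, add_zero]
    have habs : 0 ≤ (c - |(F z₀).im|) ^ 2 := sq_nonneg _
    rw [← sq_abs (F z₀).im] at hre
    by_contra! hcon
    nlinarith [mul_pos hc (sub_pos.mpr hcon)]

/-- If `h` is holomorphic in the unit disc with `h 0 = 0` and `re (h' z / z ^ k) > 0` in the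
punctured disc, then `re (h z / z ^ (k + 1)) > 0` there. -/
theorem re_div_pow_succ_pos {h : ℂ → ℂ} {k : ℕ}
    (hh : DifferentiableOn ℂ h (Metric.ball 0 1)) (h0 : h 0 = 0)
    (hpos : ∀ z : ℂ, ‖z‖ < 1 → z ≠ 0 → 0 < (deriv h z / z ^ k).re)
    {z : ℂ} (hz : ‖z‖ < 1) (hz0 : z ≠ 0) : 0 < (h z / z ^ (k + 1)).re := by
  have hd : ∀ t ∈ Set.Icc (0 : ℝ) 1, HasDerivAt (fun t : ℝ => (h (t * z) / z ^ (k + 1)).re)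
      (deriv h (t * z) / z ^ k).re t := by
    intro t ht
    have hmem : (t : ℂ) * z ∈ Metric.ball (0 : ℂ) 1 := by
      rw [mem_ball_zero_iff, norm_mul, Complex.norm_real, Real.norm_of_nonneg ht.1]
      exact (mul_le_of_le_one_left (norm_nonneg z) ht.2).trans_lt hz
    have hht := (hh.differentiableAt (Metric.isOpen_ball.mem_nhds hmem)).hasDerivAt
    have hcomp : HasDerivAt (fun s : ℂ => h (s * z) / z ^ (k + 1))
        (deriv h (t * z) * (1 * z) / z ^ (k + 1)) t :=
      (hht.comp (t : ℂ) ((hasDerivAt_id (t : ℂ)).mul_const z)).div_const _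
    have heq : deriv h (t * z) * (1 * z) / z ^ (k + 1) = deriv h (t * z) / z ^ k := by
      field_simp
      ring
    rw [heq] at hcomp
    exact hcomp.real_of_complex
  have hmono := strictMonoOn_of_deriv_pos (convex_Icc (0 : ℝ) 1)
    (fun t ht => (hd t ht).continuousAt.continuousWithinAt) (by
      intro t ht
      rw [interior_Icc] at ht
      rw [(hd t ⟨ht.1.le, ht.2.le⟩).deriv]
      have htz : ‖(t : ℂ) * z‖ < 1 := by
        rw [norm_mul, Complex.norm_real, Real.norm_of_nonneg ht.1.le]
        exact (mul_le_of_le_one_left (norm_nonneg z) ht.2.le).trans_lt hz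
      have ht0 : (t : ℂ) ≠ 0 := Complex.ofReal_ne_zero.mpr ht.1.ne'
      have hp := hpos _ htz (mul_ne_zero ht0 hz0)
      have heq : deriv h (t * z) / z ^ k = ((t ^ k : ℝ) : ℂ) * (deriv h (t * z) / (t * z) ^ k) := by
        rw [mul_pow]
        push_cast
        field_simp
      rw [heq, Complex.re_ofReal_mul]
      exact mul_pos (pow_pos ht.1 k) hp)
  simpa [h0] using hmono (Set.left_mem_Icc.mpr zero_le_one) (Set.right_mem_Icc.mpr zero_le_one)
    one_pos

/-- If `f(z) = z^p + ⋯` is analytic in the unit disc and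
`|arg f^{(p)}(z)| < 3π/4` on the disc, then for every `k ∈ {0,…,p-1}`,
`Re(f^{(p-k-1)}(z)/z^{k+1}) > 0` on the punctured disc. -/
theorem stmt_2 (p : ℕ) (hp : 1 ≤ p) (f : ℂ → ℂ)
    (hf : AnalyticOnNhd ℂ f {z : ℂ | ‖z‖ < 1})
    (hf0 : ∀ k < p, iteratedDeriv k f 0 = 0)
    (hfp : iteratedDeriv p f 0 = (p.factorial : ℂ))
    (harg : ∀ z : ℂ, ‖z‖ < 1 →
      |Complex.arg (iteratedDeriv p f z)| < 3 * Real.pi / 4) :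
    ∀ k : ℕ, k ≤ p - 1 → ∀ z : ℂ, ‖z‖ < 1 → z ≠ 0 →
      0 < (iteratedDeriv (p - k - 1) f z / z ^ (k + 1)).re := by
  have hdiff : ∀ n, DifferentiableOn ℂ (iteratedDeriv n f) (Metric.ball 0 1) := by
    intro n z hz
    rw [iteratedDeriv_eq_iterate]
    exact (hf.iterated_deriv n z (by simpa using hz)).differentiableAt.differentiableWithinAt
  intro k
  induction k with
  | zero =>
    intro _ z hz hz0
    have hderiv : deriv (iteratedDeriv (p - 1) f) = iteratedDeriv p f := by
      rw [← iteratedDeriv_succ, Nat.sub_add_cancel hp]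
    simpa using re_div_pos_of_abs_arg_deriv_lt (c := p.factorial)
      (by exact_mod_cast p.factorial_pos) (hdiff (p - 1)) (hf0 _ (by lia))
      (by rw [hderiv, hfp]; simp) (by rwa [hderiv]) hz hz0
  | succ k ih =>
    intro hk z hz hz0
    have hderiv : deriv (iteratedDeriv (p - (k + 1) - 1) f) = iteratedDeriv (p - k - 1) f := by
      rw [← iteratedDeriv_succ]
      congr 1
      lia
    exact re_div_pow_succ_pos (hdiff _) (hf0 _ (by lia))
      (by rw [hderiv]; exact ih (by lia)) hz hz0
end

section
/- Let p ≥ 2 be an integer and let f(z) = z^p + ∑_{n=p+1}^∞ a_n z^n be analytic in the open unit disc 𝔻. If |arg f^{(p)}(z)| < 3π/4 for all z ∈ 𝔻, then f is p-valent in 𝔻, i.e. for every complex number w the set {z ∈ 𝔻 : f(z) = w} has at most p elements. -/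
open Complex Real

/-- The zero-counting formula for a function all of whose zeros in a disc are simple. -/
lemma circleIntegral_deriv_div_eq_card {R r : ℝ} (hr : 0 < r) (hrR : r < R) (Z : Finset ℂ) :
    ∀ F : ℂ → ℂ, DifferentiableOn ℂ F (Metric.ball 0 R) →
      (∀ z, ‖z‖ ≤ r → (F z = 0 ↔ z ∈ Z)) → (∀ z ∈ Z, ‖z‖ < r ∧ deriv F z ≠ 0) →
      (∮ z in C(0, r), deriv F z / F z) = 2 * π * I * Z.card := by
  have hmem : ∀ z : ℂ, ‖z‖ ≤ r → Metric.ball (0 : ℂ) R ∈ nhds z := fun z hz =>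
    Metric.isOpen_ball.mem_nhds (by simpa using hz.trans_lt hrR)
  have hsub : Metric.closedBall (0 : ℂ) r ⊆ Metric.ball 0 R :=
    Metric.closedBall_subset_ball hrR
  induction Z using Finset.induction_on with
  | empty =>
    intro F hF hZ _
    have hd : DifferentiableOn ℂ (fun z => deriv F z / F z) (Metric.closedBall 0 r) := by
      refine ((hF.deriv Metric.isOpen_ball).mono hsub).div (hF.mono hsub) ?_
      intro z hz h0
      have := (hZ z (by simpa using hz)).1 h0
      simp at this
    simpa using Complex.circleIntegral_eq_zero_of_differentiable_on_off_countable hr.le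
      Set.countable_empty hd.continuousOn
      (fun z hz => hd.differentiableAt (Metric.closedBall_mem_nhds_of_mem hz.1))
  | insert a s ha ih =>
    intro F hF hZ hs
    obtain ⟨har, hFa'⟩ := hs a (Finset.mem_insert_self _ _)
    have hFa : F a = 0 := (hZ a har.le).2 (Finset.mem_insert_self _ _)
    set g := dslope F a with hg
    have hgd : DifferentiableOn ℂ g (Metric.ball 0 R) :=
      (Complex.differentiableOn_dslope (hmem a har.le)).2 hF
    have hfac : ∀ z, F z = (z - a) * g z := by
      intro z
      have := sub_smul_dslope F a z
      simpa [hFa, smul_eq_mul] using this.symm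
    have hga : g a = deriv F a := by simp [hg]
    have hder : ∀ z, ‖z‖ ≤ r → deriv F z = g z + (z - a) * deriv g z := by
      intro z hz
      have h1 : HasDerivAt (fun z => (z - a) * g z) (1 * g z + (z - a) * deriv g z) z :=
        ((hasDerivAt_id z).sub_const a).mul (hgd.differentiableAt (hmem z hz)).hasDerivAt
      have h2 : F = fun z => (z - a) * g z := funext hfac
      rw [one_mul, ← h2] at h1
      exact h1.deriv
    have hgZ : ∀ z, ‖z‖ ≤ r → (g z = 0 ↔ z ∈ s) := by
      intro z hz
      rcases eq_or_ne z a with rfl | hne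
      · simp [hga, hFa', ha]
      · have h := hZ z hz
        rw [hfac z, mul_eq_zero, sub_eq_zero, Finset.mem_insert] at h
        simpa [hne] using h
    have hgs : ∀ z ∈ s, ‖z‖ < r ∧ deriv g z ≠ 0 := by
      intro z hz
      obtain ⟨h1, h2⟩ := hs z (Finset.mem_insert_of_mem hz)
      refine ⟨h1, fun h0 => h2 ?_⟩
      rw [hder z h1.le, h0, (hgZ z h1.le).2 hz]; simp
    have hgne : ∀ z ∈ Metric.sphere (0 : ℂ) r, g z ≠ 0 := by
      intro z hz h0
      have hz' : ‖z‖ = r := by simpa using hz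
      have := (hgs z ((hgZ z hz'.le).1 h0)).1
      linarith
    have hane : ∀ z ∈ Metric.sphere (0 : ℂ) r, z - a ≠ 0 := by
      intro z hz h0
      have hz' : ‖z‖ = r := by simpa using hz
      rw [sub_eq_zero] at h0
      rw [h0] at hz'; linarith
    have hss : Metric.sphere (0 : ℂ) r ⊆ Metric.ball 0 R :=
      Metric.sphere_subset_closedBall.trans hsub
    have hcongr : (∮ z in C(0, r), deriv F z / F z)
        = ∮ z in C(0, r), ((z - a)⁻¹ + deriv g z / g z) := by
      refine circleIntegral.integral_congr hr.le fun z hz => ?_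
      have h1 := hgne z hz
      have h2 := hane z hz
      have hz' : ‖z‖ = r := by simpa using hz
      simp only [hder z hz'.le]
      rw [hfac z]
      field_simp
    rw [hcongr, circleIntegral.integral_add, ih g hgd hgZ hgs,
      circleIntegral.integral_sub_inv_of_mem_ball (by simpa using har),
      Finset.card_insert_of_notMem ha]
    · push_cast; ring
    · exact ((continuousOn_id.sub continuousOn_const).inv₀ hane).circleIntegrable hr.le
    · exact (((hgd.deriv Metric.isOpen_ball).continuousOn.mono hss).div
        (hgd.continuousOn.mono hss) hgne).circleIntegrable hr.le

/-- A differentiable function that has negative derivative wherever it takes the value `c`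
cannot climb through `c`. -/
lemma false_of_deriv_neg_of_lt_of_le {S S' : ℝ → ℝ} (hS : ∀ x, HasDerivAt S (S' x) x)
    {a b c : ℝ} (hab : a ≤ b) (hac : S a < c) (hbc : c ≤ S b)
    (hneg : ∀ x, S x = c → S' x < 0) : False := by
  have hcont : Continuous S := continuous_iff_continuousAt.2 fun x => (hS x).continuousAt
  have hclosed : IsClosed {x | c ≤ S x} := isClosed_le continuous_const hcont
  have hcomp : IsCompact (Set.Icc a b ∩ {x | c ≤ S x}) := isCompact_Icc.inter_right hclosed
  obtain ⟨x, ⟨⟨hax, hxb⟩, hx⟩, hmin⟩ := hcomp.exists_isLeast ⟨b, ⟨hab, le_rfl⟩, hbc⟩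
  have hlt : ∀ y, a ≤ y → y < x → S y < c := by
    intro y hay hyx
    by_contra h
    exact absurd (hmin ⟨⟨hay, hyx.le.trans hxb⟩, not_lt.1 h⟩) (not_le.2 hyx)
  have hax' : a < x := lt_of_le_of_ne hax (by rintro rfl; exact absurd hx (not_le.2 hac))
  have hev : ∀ᶠ y in nhdsWithin x (Set.Iio x), S y < c := by
    filter_upwards [Ioo_mem_nhdsLT hax'] with y hy using hlt y hy.1.le hy.2
  have hxc : S x = c :=
    le_antisymm (le_of_tendsto (hcont.continuousAt.mono_left nhdsWithin_le_nhds)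
      (hev.mono fun _ h => h.le)) hx
  have hder := hneg x hxc
  have hslope := (hasDerivWithinAt_iff_tendsto_slope' (s := Set.Iio x) (by simp)).1
    (hS x).hasDerivWithinAt
  have : 0 ≤ S' x := by
    refine ge_of_tendsto hslope ?_
    filter_upwards [hev, self_mem_nhdsWithin] with y hy hyx
    rw [slope_def_field, hxc]
    exact div_nonneg_of_nonpos (by linarith) (by have := Set.mem_Iio.1 hyx; linarith)
  linarith

/-- If `Re (conj z ^ k * g' z) > 0` on the punctured unit disc and `g 0 = 0`, then
`Re (conj z ^ (k + 1) * g z) > 0` there, by monotonicity along radii. -/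
lemma re_conj_pow_mul_pos {g g' : ℂ → ℂ} (k : ℕ)
    (hg : ∀ z : ℂ, ‖z‖ < 1 → HasDerivAt g (g' z) z) (hg0 : g 0 = 0)
    (hpos : ∀ z : ℂ, ‖z‖ < 1 → z ≠ 0 → 0 < ((starRingEnd ℂ) z ^ k * g' z).re)
    (z : ℂ) (hz : ‖z‖ < 1) (hz0 : z ≠ 0) : 0 < ((starRingEnd ℂ) z ^ (k + 1) * g z).re := by
  have hlt : ∀ t ∈ Set.Icc (0 : ℝ) 1, ‖(t : ℂ) * z‖ < 1 := by
    intro t ht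
    rw [norm_mul, Complex.norm_real, Real.norm_of_nonneg ht.1]
    exact (mul_le_of_le_one_left (norm_nonneg _) ht.2).trans_lt hz
  have hd : ∀ t ∈ Set.Icc (0 : ℝ) 1,
      HasDerivAt (fun t : ℝ => ((starRingEnd ℂ) z ^ (k + 1) * g (t * z)).re)
        ((starRingEnd ℂ) z ^ (k + 1) * (g' (t * z) * z)).re t := by
    intro t ht
    have h1 : HasDerivAt (fun w : ℂ => w * z) z (t : ℂ) := by
      simpa using (hasDerivAt_id (t : ℂ)).mul_const z
    have h2 : HasDerivAt (fun w : ℂ => g (w * z)) (g' (t * z) * z) (t : ℂ) :=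
      (hg _ (hlt t ht)).comp (t : ℂ) h1
    exact (h2.const_mul ((starRingEnd ℂ) z ^ (k + 1))).real_of_complex
  have hmono := strictMonoOn_of_deriv_pos (convex_Icc (0 : ℝ) 1)
    (fun t ht => (hd t ht).continuousAt.continuousWithinAt) (by
      intro t ht
      rw [interior_Icc] at ht
      rw [(hd t ⟨ht.1.le, ht.2.le⟩).deriv]
      have ht0 : (t : ℂ) * z ≠ 0 := mul_ne_zero (by exact_mod_cast ht.1.ne') hz0
      have h := hpos _ (hlt t ⟨ht.1.le, ht.2.le⟩) ht0
      rw [map_mul, Complex.conj_ofReal, mul_pow, mul_assoc, ← Complex.ofReal_pow,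
        Complex.re_ofReal_mul] at h
      have h' := (mul_pos_iff_of_pos_left (pow_pos ht.1 k)).1 h
      have e : (starRingEnd ℂ) z ^ (k + 1) * (g' (t * z) * z)
          = ((Complex.normSq z : ℝ) : ℂ) * ((starRingEnd ℂ) z ^ k * g' (t * z)) := by
        rw [← Complex.mul_conj]; ring
      rw [e, Complex.re_ofReal_mul]
      exact mul_pos (Complex.normSq_pos.2 hz0) h')
  have := hmono (Set.left_mem_Icc.2 zero_le_one) (Set.right_mem_Icc.2 zero_le_one) zero_lt_one
  simpa [hg0] using this

/-- If `Re (z F'(z) / F(z)) < p` at every point of the circle `‖z‖ = r` where `F z / z ^ p` is a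
negative real, then the winding number of `F` along the circle is at most `p`. -/
lemma winding_le_of_re_lt {R r : ℝ} (hr : 0 < r) (hrR : r < R) {F : ℂ → ℂ} (N p : ℕ)
    (hF : DifferentiableOn ℂ F (Metric.ball 0 R)) (hne : ∀ z, ‖z‖ = r → F z ≠ 0)
    (hN : (∮ z in C(0, r), deriv F z / F z) = 2 * π * I * N)
    (hneg : ∀ z : ℂ, ‖z‖ = r → ∀ t : ℝ, 0 < t → F z = -(t : ℂ) * z ^ p →
      (z * deriv F z / F z).re < p) : N ≤ p := by
  have hnorm : ∀ θ : ℝ, ‖circleMap 0 r θ‖ = r := by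
    intro θ; simp [abs_of_pos hr]
  have hnhds : ∀ z : ℂ, ‖z‖ = r → Metric.ball (0 : ℂ) R ∈ nhds z := fun z hz =>
    Metric.isOpen_ball.mem_nhds (by simpa [hz] using hrR)
  set ℓ : ℝ → ℂ := fun θ =>
    circleMap 0 r θ * I * (deriv F (circleMap 0 r θ) / F (circleMap 0 r θ)) - p * I with hℓ
  have hcirc : Continuous (fun θ : ℝ => circleMap 0 r θ) := continuous_circleMap 0 r
  have hFc : Continuous (fun θ => F (circleMap 0 r θ)) := continuous_iff_continuousAt.2 fun θ =>
    ContinuousAt.comp (f := fun θ => circleMap 0 r θ)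
      (hF.differentiableAt (hnhds _ (hnorm θ))).continuousAt hcirc.continuousAt
  have hF'c : Continuous (fun θ => deriv F (circleMap 0 r θ)) :=
    continuous_iff_continuousAt.2 fun θ =>
    ContinuousAt.comp (f := fun θ => circleMap 0 r θ)
      ((hF.deriv Metric.isOpen_ball).differentiableAt (hnhds _ (hnorm θ))).continuousAt
      hcirc.continuousAt
  have hℓc : Continuous ℓ :=
    ((hcirc.mul continuous_const).mul (hF'c.div hFc fun θ => hne _ (hnorm θ))).sub
      continuous_const
  set G : ℝ → ℂ := fun θ => F (circleMap 0 r θ) * Complex.exp (-(p * I * θ)) with hG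
  have hG0 : G 0 ≠ 0 := mul_ne_zero (hne _ (hnorm 0)) (Complex.exp_ne_zero _)
  set L : ℝ → ℂ := fun θ => Complex.log (G 0) + ∫ x in (0 : ℝ)..θ, ℓ x with hL
  have hLd : ∀ θ, HasDerivAt L (ℓ θ) θ := fun θ =>
    (intervalIntegral.integral_hasDerivAt_right (hℓc.intervalIntegrable _ _)
      hℓc.aestronglyMeasurable.stronglyMeasurableAtFilter hℓc.continuousAt).const_add _
  have hGd : ∀ θ, HasDerivAt G (G θ * ℓ θ) θ := by
    intro θ
    have h1 : HasDerivAt (fun θ => F (circleMap 0 r θ))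
        (deriv F (circleMap 0 r θ) * (circleMap 0 r θ * I)) θ :=
      (hF.differentiableAt (hnhds _ (hnorm θ))).hasDerivAt.comp θ (hasDerivAt_circleMap 0 r θ)
    have h2 : HasDerivAt (fun θ : ℝ => Complex.exp (-(p * I * θ)))
        (Complex.exp (-(p * I * θ)) * (-(p * I * 1))) θ :=
      (((Complex.ofRealCLM.hasDerivAt (x := θ)).const_mul (p * I)).neg).cexp
    refine (h1.mul h2).congr_deriv ?_
    have := hne _ (hnorm θ)
    simp only [hG, hℓ]
    field_simp
    ring
  have hexp : ∀ θ, Complex.exp (L θ) = G θ := by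
    have hd : ∀ θ, HasDerivAt (fun θ => G θ * Complex.exp (-L θ)) 0 θ := by
      intro θ
      refine ((hGd θ).mul (hLd θ).neg.cexp).congr_deriv ?_
      simp only [Pi.neg_apply]
      ring
    intro θ
    have hconst := is_const_of_deriv_eq_zero (fun θ => (hd θ).differentiableAt)
      (fun θ => (hd θ).deriv) θ 0
    have hL0 : Complex.exp (L 0) = G 0 := by simp [hL, Complex.exp_log hG0]
    simp only [Complex.exp_neg, hL0, mul_inv_cancel₀ hG0] at hconst
    field_simp at hconst
    exact hconst.symm
  have hLend : L (2 * π) - L 0 = 2 * π * I * N - 2 * π * I * p := by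
    have h1 : (∫ x in (0 : ℝ)..(2 * π), ℓ x) = 2 * π * I * N - 2 * π * I * p := by
      rw [← hN, circleIntegral, hℓ, intervalIntegral.integral_sub]
      · simp [deriv_circleMap, smul_eq_mul]
        ring
      · exact ((hcirc.mul continuous_const).mul
          (hF'c.div hFc fun θ => hne _ (hnorm θ))).intervalIntegrable _ _
      · exact continuous_const.intervalIntegrable _ _
    simp [hL, h1]
  by_contra hlt
  push Not at hlt
  have hNp : (p : ℝ) + 1 ≤ N := by exact_mod_cast hlt
  have hS : ∀ θ, HasDerivAt (fun θ => (L θ).im) (ℓ θ).im θ := fun θ =>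
    Complex.imCLM.hasFDerivAt.comp_hasDerivAt θ (hLd θ)
  have hSend : (L (2 * π)).im - (L 0).im = 2 * π * (N - p) := by
    have := congrArg Complex.im hLend
    simp at this
    linarith
  set m : ℤ := ⌊((L 0).im - π) / (2 * π)⌋ + 1 with hm
  have hpi := Real.pi_pos
  have hm1 : ((L 0).im - π) / (2 * π) < m := by
    rw [hm]; push_cast; exact Int.lt_floor_add_one _
  have hm2 : (m : ℝ) ≤ ((L 0).im - π) / (2 * π) + 1 := by
    rw [hm]; push_cast; linarith [Int.floor_le (((L 0).im - π) / (2 * π))]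
  rw [div_lt_iff₀ (by positivity)] at hm1
  have hm3 : m * (2 * π) ≤ (L 0).im - π + 2 * π := by
    have := mul_le_mul_of_nonneg_right hm2 (by positivity : 0 ≤ 2 * π)
    rw [add_mul, div_mul_cancel₀ _ (by positivity)] at this
    linarith
  refine false_of_deriv_neg_of_lt_of_le hS (a := 0) (b := 2 * π) (c := π + m * (2 * π))
    (by positivity) (by linarith) ?_ ?_
  · nlinarith
  · intro θ hθ
    set z := circleMap 0 r θ with hz
    have hFz : F z = -((Real.exp (L θ).re / r ^ p : ℝ) : ℂ) * z ^ p := by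
      have h1 : Complex.exp (L θ) = -(Real.exp (L θ).re : ℂ) := by
        rw [← Complex.re_add_im (L θ), hθ, Complex.exp_add]
        have : (((π + m * (2 * π) : ℝ) : ℂ) * I) = π * I + m * (2 * π * I) := by
          push_cast; ring
        rw [this, Complex.exp_add, Complex.exp_pi_mul_I, Complex.exp_int_mul_two_pi_mul_I]
        simp
      have h2 : z ^ p = (r : ℂ) ^ p * Complex.exp (p * I * θ) := by
        rw [hz, circleMap_zero, mul_pow, ← Complex.exp_nat_mul]
        ring_nf
      have h3 := (hexp θ).symm.trans h1
      simp only [hG, Complex.exp_neg] at h3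
      have h4 := Complex.exp_ne_zero (p * I * θ)
      have hrne : (r : ℂ) ≠ 0 := by exact_mod_cast hr.ne'
      rw [h2]
      push_cast
      field_simp at h3 ⊢
      simpa [hz] using h3
    have h := hneg z (hnorm θ) _ (by positivity) hFz
    have e : (ℓ θ).im = (z * deriv F z / F z).re - p := by
      have : ℓ θ = I * (z * deriv F z / F z - p) := by
        simp only [hℓ, ← hz]; ring
      rw [this, Complex.I_mul_im]; simp
    rw [e]; linarith

/-- If `|arg (q + z q')| < 3π/4` on the unit disc and `q 0 = 1`, then `Re q > 0`. -/
lemma re_pos_of_abs_arg_add_mul_deriv_lt {q : ℂ → ℂ}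
    (hq : DifferentiableOn ℂ q (Metric.ball 0 1)) (hq0 : q 0 = 1)
    (harg : ∀ z : ℂ, ‖z‖ < 1 → |Complex.arg (q z + z * deriv q z)| < 3 * π / 4)
    (z : ℂ) (hz : ‖z‖ < 1) : 0 < (q z).re := by
  by_contra hcon
  push Not at hcon
  have hda : ∀ w : ℂ, ‖w‖ < 1 → DifferentiableAt ℂ q w := fun w hw =>
    hq.differentiableAt (Metric.isOpen_ball.mem_nhds (by simpa using hw))
  -- a point of minimal modulus with `Re q ≤ 0`
  obtain ⟨a, ha, hare, hmin⟩ : ∃ a : ℂ, ‖a‖ < 1 ∧ (q a).re ≤ 0 ∧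
      ∀ w : ℂ, ‖w‖ < ‖a‖ → 0 < (q w).re := by
    have hsub : Metric.closedBall (0 : ℂ) ‖z‖ ⊆ Metric.ball 0 1 :=
      Metric.closedBall_subset_ball hz
    have hcl : IsClosed (Metric.closedBall (0 : ℂ) ‖z‖ ∩ {w | (q w).re ≤ 0}) :=
      (Complex.continuous_re.comp_continuousOn
        (hq.continuousOn.mono hsub)).preimage_isClosed_of_isClosed
        Metric.isClosed_closedBall isClosed_Iic
    have hcp := (isCompact_closedBall (0 : ℂ) ‖z‖).of_isClosed_subset hcl Set.inter_subset_left
    obtain ⟨a, ⟨ha1, ha2⟩, hmin⟩ := hcp.exists_isMinOn ⟨z, by simp, hcon⟩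
      continuous_norm.continuousOn
    have ha1' : ‖a‖ ≤ ‖z‖ := by simpa using ha1
    refine ⟨a, ha1'.trans_lt hz, ha2, fun w hw => ?_⟩
    by_contra hw0
    have : ‖a‖ ≤ ‖w‖ := hmin ⟨by simpa using hw.le.trans ha1', not_lt.1 hw0⟩
    linarith
  have ha0 : a ≠ 0 := by
    rintro rfl
    rw [hq0] at hare; norm_num at hare
  have hapos : 0 < ‖a‖ := norm_pos_iff.2 ha0
  -- `Re q ≥ 0` on the circle of radius `‖a‖`
  have hnonneg : ∀ w : ℂ, ‖w‖ = ‖a‖ → 0 ≤ (q w).re := by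
    intro w hw
    have hc : ContinuousAt (fun t : ℝ => (q (t * w)).re) 1 := by
      have h1 : ContinuousAt q ((1 : ℝ) * w) := by
        simpa using (hda w (hw ▸ ha)).continuousAt
      exact Complex.continuous_re.continuousAt.comp
        (ContinuousAt.comp (f := fun t : ℝ => (t : ℂ) * w) h1 (by fun_prop))
    have ht : Filter.Tendsto (fun t : ℝ => (q (t * w)).re) (nhdsWithin 1 (Set.Iio 1))
        (nhds (q w).re) := by
      simpa [ContinuousAt] using hc.mono_left nhdsWithin_le_nhds
    refine ge_of_tendsto ht ?_
    filter_upwards [Ioo_mem_nhdsLT (zero_lt_one' ℝ)] with t ht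
    refine (hmin _ ?_).le
    rw [norm_mul, Complex.norm_real, Real.norm_of_nonneg ht.1.le, hw]
    exact mul_lt_of_lt_one_left hapos ht.2
  have hre0 : (q a).re = 0 := le_antisymm hare (hnonneg a rfl)
  -- the tangential derivative of `Re q` vanishes at `a`
  have him : (a * deriv q a).im = 0 := by
    have h1 : HasDerivAt (fun w : ℂ => a * Complex.exp (w * I)) (a * I) ((0 : ℝ) : ℂ) := by
      simpa using (((hasDerivAt_id ((0 : ℝ) : ℂ)).mul_const I).cexp).const_mul a
    have h2 : HasDerivAt q (deriv q a) (a * Complex.exp (((0 : ℝ) : ℂ) * I)) := by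
      simpa using (hda a ha).hasDerivAt
    have h3 : HasDerivAt (fun θ : ℝ => (q (a * Complex.exp (θ * I))).re)
        (deriv q a * (a * I)).re 0 :=
      (HasDerivAt.comp (h := fun w : ℂ => a * Complex.exp (w * I)) _ h2 h1).real_of_complex
    have hloc : IsLocalMin (fun θ : ℝ => (q (a * Complex.exp (θ * I))).re) 0 := by
      refine Filter.Eventually.of_forall fun θ => ?_
      have : 0 ≤ (q (a * Complex.exp (θ * I))).re :=
        hnonneg _ (by simp [Complex.norm_exp_ofReal_mul_I])
      simpa [hre0] using this
    have h4 := hloc.hasDerivAt_eq_zero h3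
    have e : deriv q a * (a * I) = I * (a * deriv q a) := by ring
    rw [e, Complex.I_mul_re] at h4
    linarith
  -- the radial derivative is bounded by the Schwarz lemma
  have hschw : ∀ w : ℂ, ‖w‖ < ‖a‖ → ‖(1 - q w) / (1 + q w)‖ ≤ 1 / ‖a‖ * ‖w‖ := by
    have hne : ∀ w : ℂ, ‖w‖ < ‖a‖ → 1 + q w ≠ 0 := by
      intro w hw h0
      have := congrArg Complex.re h0
      have h1 := hmin w hw
      simp at this
      linarith
    have hd : DifferentiableOn ℂ (fun w => (1 - q w) / (1 + q w)) (Metric.ball 0 ‖a‖) := by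
      have hq' := hq.mono (Metric.ball_subset_ball ha.le)
      exact (hq'.const_sub 1).div (hq'.const_add 1) fun w hw => hne w (by simpa using hw)
    have hmaps : Set.MapsTo (fun w => (1 - q w) / (1 + q w)) (Metric.ball 0 ‖a‖)
        (Metric.closedBall ((1 - q 0) / (1 + q 0)) 1) := by
      intro w hw
      have hw' : ‖w‖ < ‖a‖ := by simpa using hw
      have h1 := hmin w hw'
      simp only [hq0, sub_self, zero_div, mem_closedBall_zero_iff, norm_div]
      rw [div_le_one (norm_pos_iff.2 (hne w hw'))]
      refine abs_le_of_sq_le_sq' ?_ (norm_nonneg _) |>.2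
      rw [← Complex.normSq_eq_norm_sq, ← Complex.normSq_eq_norm_sq, Complex.normSq_apply,
        Complex.normSq_apply]
      simp
      nlinarith
    intro w hw
    have := Complex.dist_le_div_mul_dist_of_mapsTo_ball hd hmaps (z := w) (by simpa using hw)
    simpa [hq0] using this
  have hineq : ∀ t ∈ Set.Ioo (0 : ℝ) 1,
      (1 - t ^ 2) * (1 + Complex.normSq (q (t * a))) ≤ 2 * (q (t * a)).re * (1 + t ^ 2) := by
    intro t ht
    have hta : ‖(t : ℂ) * a‖ = t * ‖a‖ := by
      rw [norm_mul, Complex.norm_real, Real.norm_of_nonneg ht.1.le]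
    have hlt : ‖(t : ℂ) * a‖ < ‖a‖ := by
      rw [hta]; exact mul_lt_of_lt_one_left hapos ht.2
    have h1 := hmin _ hlt
    have h2 := hschw _ hlt
    have hne : 1 + q (t * a) ≠ 0 := by
      intro h0
      have := congrArg Complex.re h0
      simp at this
      linarith
    rw [hta, norm_div, div_le_iff₀ (norm_pos_iff.2 hne)] at h2
    have h3 : ‖1 - q (t * a)‖ ≤ t * ‖1 + q (t * a)‖ := by
      calc _ ≤ _ := h2
        _ = _ := by field_simp
    have h4 := pow_le_pow_left₀ (norm_nonneg _) h3 2
    rw [mul_pow, ← Complex.normSq_eq_norm_sq, ← Complex.normSq_eq_norm_sq, Complex.normSq_apply,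
      Complex.normSq_apply] at h4
    rw [Complex.normSq_apply]
    simp at h4
    nlinarith
  have hradial : 1 + Complex.normSq (q a) ≤ -2 * (a * deriv q a).re := by
    have h1 : HasDerivAt (fun w : ℂ => w * a) a ((1 : ℝ) : ℂ) := by
      simpa using (hasDerivAt_id ((1 : ℝ) : ℂ)).mul_const a
    have h2 : HasDerivAt q (deriv q a) (((1 : ℝ) : ℂ) * a) := by
      simpa using (hda a ha).hasDerivAt
    have hu : HasDerivAt (fun t : ℝ => (q (t * a)).re) (a * deriv q a).re 1 := by
      have := (HasDerivAt.comp (h := fun w : ℂ => w * a) _ h2 h1).real_of_complex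
      rwa [mul_comm] at this
    have hslope := (hasDerivWithinAt_iff_tendsto_slope' (s := Set.Iio (1 : ℝ)) (by simp)).1
      hu.hasDerivWithinAt
    have hc : ContinuousAt (fun t : ℝ => Complex.normSq (q (t * a))) 1 :=
      Complex.continuous_normSq.continuousAt.comp
        (ContinuousAt.comp (f := fun t : ℝ => (t : ℂ) * a) h2.continuousAt (by fun_prop))
    have hrhs : Filter.Tendsto
        (fun t : ℝ => -((1 + t) * (1 + Complex.normSq (q (t * a))) / (2 * (1 + t ^ 2))))
        (nhdsWithin 1 (Set.Iio 1)) (nhds (-((1 + Complex.normSq (q a)) / 2))) := by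
      have h : ContinuousAt
          (fun t : ℝ => -((1 + t) * (1 + Complex.normSq (q (t * a))) / (2 * (1 + t ^ 2)))) 1 := by
        refine ContinuousAt.neg (ContinuousAt.div ?_ (by fun_prop) (by norm_num))
        exact (by fun_prop : ContinuousAt (fun t : ℝ => 1 + t) 1).mul (continuousAt_const.add hc)
      have h' := h.mono_left (nhdsWithin_le_nhds (s := Set.Iio 1))
      convert h' using 2
      simp
      ring
    have hle := le_of_tendsto_of_tendsto hslope hrhs (by
      filter_upwards [Ioo_mem_nhdsLT (zero_lt_one' ℝ)] with t ht
      have h := hineq t ht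
      rw [slope_def_field]
      simp only [Complex.ofReal_one, one_mul, hre0, sub_zero]
      rw [div_le_iff_of_neg (by linarith [ht.2]), neg_mul, div_mul_eq_mul_div, ← neg_div,
        div_le_iff₀ (by positivity)]
      linarith)
    linarith
  -- hence `q a + a q'(a)` lies outside the sector
  set P := q a + a * deriv q a with hP
  have hPre : P.re = (a * deriv q a).re := by simp [hP, hre0]
  have hPim : P.im = (q a).im := by rw [hP, Complex.add_im, him, add_zero]
  rw [Complex.normSq_apply, hre0, ← hPim, ← hPre] at hradial
  have hPneg : P.re < 0 := by nlinarith [mul_self_nonneg P.im]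
  have hP0 : P ≠ 0 := fun h => by simp [h] at hPneg
  have hcos := Complex.cos_arg hP0
  have hlt : Real.cos (3 * π / 4) < Real.cos |Complex.arg P| :=
    Real.cos_lt_cos_of_nonneg_of_le_pi (abs_nonneg _) (by linarith [Real.pi_pos]) (harg a ha)
  rw [Real.cos_abs, hcos, show 3 * π / 4 = π - π / 4 by ring, Real.cos_pi_sub,
    Real.cos_pi_div_four, lt_div_iff₀ (norm_pos_iff.2 hP0)] at hlt
  have hsq : P.im * P.im ≤ P.re * P.re := by
    nlinarith [mul_self_nonneg (P.im * P.im - 1), mul_self_nonneg P.im,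
      mul_self_nonneg (P.im - 1), mul_self_nonneg (P.im + 1)]
  have hn : ‖P‖ ^ 2 = P.re * P.re + P.im * P.im := by
    rw [← Complex.normSq_eq_norm_sq, Complex.normSq_apply]
  have h2 : Real.sqrt 2 ^ 2 = 2 := Real.sq_sqrt (by norm_num)
  have h5 : (-P.re) ^ 2 < (Real.sqrt 2 / 2 * ‖P‖) ^ 2 :=
    pow_lt_pow_left₀ (by linarith) (by linarith) (by norm_num)
  rw [mul_pow, div_pow, h2, hn] at h5
  nlinarith

/-- A function analytic on the unit disc that does not vanish at the origin has finitely many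
zeros in every smaller closed disc. -/
lemma finite_zeros_of_ne_zero {F : ℂ → ℂ} {ρ : ℝ} (hρ : ρ < 1)
    (hF : AnalyticOnNhd ℂ F (Metric.ball 0 1)) (hF0 : F 0 ≠ 0) :
    (Metric.closedBall (0 : ℂ) ρ ∩ {z | F z = 0}).Finite := by
  by_contra hinf
  obtain ⟨x, hx, hacc⟩ := Set.Infinite.exists_accPt_of_subset_isCompact hinf
    (isCompact_closedBall (0 : ℂ) ρ) Set.inter_subset_left
  rw [accPt_iff_frequently_nhdsNE] at hacc
  exact hF0 (hF.eqOn_zero_of_preconnected_of_frequently_eq_zero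
    (convex_ball (0 : ℂ) 1).isPreconnected (Metric.closedBall_subset_ball hρ hx)
    (hacc.mono fun y hy => hy.2) (by simp))

/-- If `Re (f' / z ^ (p - 1)) > 0` on the punctured unit disc, then `f` takes every value other
than `f 0 = 0` at most `p` times. -/
lemma encard_fiber_le {f : ℂ → ℂ} {p : ℕ} (hp : 1 ≤ p)
    (hf : AnalyticOnNhd ℂ f (Metric.ball 0 1)) (hf0 : f 0 = 0)
    (hpos : ∀ z : ℂ, ‖z‖ < 1 → z ≠ 0 → 0 < ((starRingEnd ℂ) z ^ (p - 1) * deriv f z).re)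
    {w : ℂ} (hw : w ≠ 0) : ({z : ℂ | ‖z‖ < 1 ∧ f z = w}).encard ≤ p := by
  by_contra hcon
  push Not at hcon
  obtain ⟨T', hT's, hT'c⟩ := Set.exists_subset_encard_eq (k := ((p + 1 : ℕ) : ℕ∞))
    (s := {z : ℂ | ‖z‖ < 1 ∧ f z = w}) (by push_cast; exact Order.add_one_le_of_lt hcon)
  have hT'f : T'.Finite := Set.finite_of_encard_eq_coe hT'c
  obtain ⟨T, rfl⟩ := hT'f.exists_finset_coe
  rw [Set.encard_coe_eq_coe_finsetCard, Nat.cast_inj] at hT'c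
  set F : ℂ → ℂ := fun z => f z - w with hFdef
  have hFa : AnalyticOnNhd ℂ F (Metric.ball 0 1) := hf.sub analyticOnNhd_const
  have hdF : ∀ z, deriv F z = deriv f z := fun z => by simp [hFdef]
  have hF0 : F 0 ≠ 0 := by simpa [hFdef, hf0] using hw
  obtain ⟨z₁, hz₁, hmax⟩ := T.exists_max_image (fun z => ‖z‖) (Finset.card_pos.1 (by omega))
  have hz₁' : ‖z₁‖ < 1 := (hT's hz₁).1
  obtain ⟨ρ, hρ₁, hρ₂⟩ := exists_between hz₁'
  have hfin := finite_zeros_of_ne_zero hρ₂ hFa hF0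
  obtain ⟨r, ⟨hr₁, hr₂⟩, hr⟩ :=
    ((Set.Ioo_infinite hρ₁).sdiff (hfin.image fun z => ‖z‖)).nonempty
  have hr0 : 0 < r := (norm_nonneg _).trans_lt hr₁
  have hr1 : r < 1 := hr₂.trans hρ₂
  have hne : ∀ z, ‖z‖ = r → F z ≠ 0 := fun z hz h0 =>
    hr ⟨z, ⟨by simpa [hz] using hr₂.le, h0⟩, hz⟩
  have hfin' : {z : ℂ | ‖z‖ ≤ r ∧ F z = 0}.Finite :=
    hfin.subset fun z hz => ⟨by simpa using hz.1.trans hr₂.le, hz.2⟩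
  have hTZ : T ⊆ hfin'.toFinset := by
    intro z hz
    rw [Set.Finite.mem_toFinset]
    exact ⟨(hmax z hz).trans hr₁.le, sub_eq_zero.2 (hT's hz).2⟩
  have hcount := circleIntegral_deriv_div_eq_card hr0 hr1 hfin'.toFinset F
    hFa.differentiableOn
    (fun z hz => by simp [hz]) (by
      intro z hz
      rw [Set.Finite.mem_toFinset] at hz
      refine ⟨lt_of_le_of_ne hz.1 fun h => hne z h hz.2, fun h0 => ?_⟩
      have hz0 : z ≠ 0 := by rintro rfl; exact hF0 hz.2
      have := hpos z (hz.1.trans_lt hr1) hz0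
      rw [← hdF, h0] at this
      simp at this)
  have hle := winding_le_of_re_lt hr0 hr1 hfin'.toFinset.card p hFa.differentiableOn hne hcount (by
    intro z hz t ht hFz
    have hz0 : z ≠ 0 := by rintro rfl; simp at hz; linarith
    have h := hpos z (hz ▸ hr1) hz0
    have hconj : (starRingEnd ℂ) z ≠ 0 := (map_ne_zero _).2 hz0
    have htc : (t : ℂ) ≠ 0 := by exact_mod_cast ht.ne'
    have e : z * deriv F z / F z = ((-(t * Complex.normSq z ^ (p - 1))⁻¹ : ℝ) : ℂ) *
        ((starRingEnd ℂ) z ^ (p - 1) * deriv f z) := by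
      obtain ⟨n, rfl⟩ : ∃ n, p = n + 1 := ⟨p - 1, by omega⟩
      rw [hFz, hdF]
      push_cast
      rw [← Complex.mul_conj, mul_pow, pow_succ]
      field_simp
    rw [e, Complex.re_ofReal_mul]
    have hn : 0 < (t * Complex.normSq z ^ (p - 1))⁻¹ :=
      inv_pos.2 (mul_pos ht (pow_pos (Complex.normSq_pos.2 hz0) _))
    have := mul_pos hn h
    have hp0 : (0 : ℝ) ≤ p := Nat.cast_nonneg p
    linarith)
  have := Finset.card_le_card hTZ
  omega

/-- If `p ≥ 2`, `f(z) = z^p + ⋯` is analytic in the unit disc and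
`|arg f^{(p)}(z)| < 3π/4` on the disc, then `f` is `p`-valent in the disc:
every value is attained at most `p` times. -/
theorem stmt_3 (p : ℕ) (hp : 2 ≤ p) (f : ℂ → ℂ)
    (hf : AnalyticOnNhd ℂ f {z : ℂ | ‖z‖ < 1})
    (hf0 : ∀ k < p, iteratedDeriv k f 0 = 0)
    (hfp : iteratedDeriv p f 0 = (p.factorial : ℂ))
    (harg : ∀ z : ℂ, ‖z‖ < 1 →
      |Complex.arg (iteratedDeriv p f z)| < 3 * Real.pi / 4) :
    ∀ w : ℂ, ({z : ℂ | ‖z‖ < 1 ∧ f z = w}).encard ≤ p := by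
  have hball : {z : ℂ | ‖z‖ < 1} = Metric.ball 0 1 := by ext z; simp
  rw [hball] at hf
  have hg : ∀ k, AnalyticOnNhd ℂ (iteratedDeriv k f) (Metric.ball 0 1) := fun k => by
    rw [iteratedDeriv_eq_iterate]; exact hf.iterated_deriv k
  have hd : ∀ k, ∀ z : ℂ, ‖z‖ < 1 →
      HasDerivAt (iteratedDeriv k f) (iteratedDeriv (k + 1) f z) z := fun k z hz => by
    rw [iteratedDeriv_succ]
    exact (hg k z (by simpa using hz)).differentiableAt.hasDerivAt
  have hp1 : p - 1 + 1 = p := by omega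
  have hfac : (0 : ℝ) < p.factorial := by exact_mod_cast p.factorial_pos
  have hfacC : (p.factorial : ℂ) ≠ 0 := by exact_mod_cast p.factorial_ne_zero
  set q : ℂ → ℂ := fun z => (p.factorial : ℂ)⁻¹ * dslope (iteratedDeriv (p - 1) f) 0 z with hq
  have hqd : DifferentiableOn ℂ q (Metric.ball 0 1) :=
    ((Complex.differentiableOn_dslope (Metric.ball_mem_nhds 0 one_pos)).2
      (hg (p - 1)).differentiableOn).const_mul _
  have hzq : ∀ z, iteratedDeriv (p - 1) f z = p.factorial * (z * q z) := by
    intro z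
    have h := sub_smul_dslope (iteratedDeriv (p - 1) f) 0 z
    rw [hf0 (p - 1) (by omega), sub_zero, sub_zero, smul_eq_mul] at h
    rw [← h, hq]
    field_simp
  have hq0 : q 0 = 1 := by
    simp only [hq, dslope_same]
    rw [← iteratedDeriv_succ, hp1, hfp, inv_mul_cancel₀ hfacC]
  have hqre := re_pos_of_abs_arg_add_mul_deriv_lt hqd hq0 (by
    intro z hz
    have h1 : HasDerivAt q (deriv q z) z :=
      (hqd.differentiableAt (Metric.isOpen_ball.mem_nhds (by simpa using hz))).hasDerivAt
    have h2 := ((hasDerivAt_id z).mul h1).const_mul (p.factorial : ℂ)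
    have h3 := hd (p - 1) z hz
    rw [hp1, funext hzq] at h3
    have h4 := h3.unique h2
    have h5 := harg z hz
    rw [h4] at h5
    simp only [id, one_mul] at h5
    rwa [show (p.factorial : ℂ) = ((p.factorial : ℝ) : ℂ) by push_cast; rfl,
      Complex.arg_real_mul _ hfac] at h5)
  have hpos : ∀ k, k + 1 ≤ p → ∀ z : ℂ, ‖z‖ < 1 → z ≠ 0 →
      0 < ((starRingEnd ℂ) z ^ (k + 1) * iteratedDeriv (p - 1 - k) f z).re := by
    intro k
    induction k with
    | zero =>
      intro _ z hz hz0
      have e : (starRingEnd ℂ) z ^ (0 + 1) * iteratedDeriv (p - 1 - 0) f z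
          = ((p.factorial * Complex.normSq z : ℝ) : ℂ) * q z := by
        rw [Nat.sub_zero, hzq]
        push_cast
        rw [← Complex.mul_conj]
        ring
      rw [e, Complex.re_ofReal_mul]
      exact mul_pos (mul_pos hfac (Complex.normSq_pos.2 hz0)) (hqre z hz)
    | succ k ih =>
      intro hk
      refine re_conj_pow_mul_pos (k + 1) (fun z hz => ?_) (hf0 _ (by omega)) (ih (by omega))
      have := hd (p - 1 - (k + 1)) z hz
      rwa [show p - 1 - (k + 1) + 1 = p - 1 - k by omega] at this
  have hf00 : f 0 = 0 := by simpa using hf0 0 (by omega)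
  intro w
  rcases eq_or_ne w 0 with rfl | hw
  · have hsub : {z : ℂ | ‖z‖ < 1 ∧ f z = 0} ⊆ {0} := by
      rintro z ⟨hz, hfz⟩
      by_contra hz0
      have := hpos (p - 1) (by omega) z hz hz0
      simp [hfz] at this
    calc _ ≤ ({0} : Set ℂ).encard := Set.encard_le_encard hsub
      _ = 1 := Set.encard_singleton 0
      _ ≤ p := by exact_mod_cast (by omega : 1 ≤ p)
  · refine encard_fiber_le (by omega) hf hf00 (fun z hz hz0 => ?_) hw
    have := hpos (p - 2) (by omega) z hz hz0
    rwa [show p - 2 + 1 = p - 1 by omega, show p - 1 - (p - 2) = 1 by omega,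
      iteratedDeriv_one] at this
end

section
/- Let γ₀ > 0 be a real number satisfying 2γ₀ + (2/π)·arctan γ₀ = 1. Let p ≥ 1 be an integer and let f(z) = z^p + ∑_{n=p+1}^∞ a_n z^n be analytic in the open unit disc 𝔻. If |arg f^{(p)}(z)| < (π/2)(γ₀ + (2/π)·arctan γ₀) for all z ∈ 𝔻, then |arg( z·f'(z)/f(z) )| < π/2 for all z ∈ 𝔻, z ≠ 0; in particular f is p-valently starlike in 𝔻. -/
open Complex Real

open Metric Topology Filter Set

lemma tendsto_radial {u : ℂ → ℝ} {z : ℂ} (hu : ContinuousAt u z) :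
    Tendsto (fun t : ℝ => u (t * z)) (𝓝[<] 1) (𝓝 (u z)) := by
  have h : ContinuousAt (fun t : ℝ => u (t * z)) 1 :=
    ContinuousAt.comp (f := fun t : ℝ => (t : ℂ) * z) (x := (1 : ℝ)) (by simpa using hu)
      (by fun_prop)
  simpa using h.tendsto.mono_left nhdsWithin_le_nhds

/-- A continuous function on the unit disc that starts below `c` and somewhere reaches `c`
attains `c` for the first time, in modulus, at some nonzero point. -/
lemma exists_first_point {u : ℂ → ℝ} {c : ℝ} (hu : ContinuousOn u (ball 0 1)) (h0 : u 0 < c)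
    {z₁ : ℂ} (hz₁ : z₁ ∈ ball (0 : ℂ) 1) (h1 : c ≤ u z₁) :
    ∃ z₀ ∈ ball (0 : ℂ) 1, z₀ ≠ 0 ∧ u z₀ = c ∧ ∀ z, ‖z‖ < ‖z₀‖ → u z < c := by
  have hz₁' : ‖z₁‖ < 1 := by simpa using hz₁
  have hsub : closedBall (0 : ℂ) ‖z₁‖ ⊆ ball 0 1 := closedBall_subset_ball hz₁'
  have hK : IsCompact (closedBall (0 : ℂ) ‖z₁‖ ∩ u ⁻¹' Ici c) :=
    (isCompact_closedBall _ _).of_isClosed_subset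
      ((hu.mono hsub).preimage_isClosed_of_isClosed isClosed_closedBall isClosed_Ici)
      inter_subset_left
  obtain ⟨z₀, ⟨hz₀, hc⟩, hmin⟩ := hK.exists_isMinOn ⟨z₁, by simp, h1⟩ continuous_norm.continuousOn
  have hlt : ∀ z, ‖z‖ < ‖z₀‖ → u z < c := by
    intro z hz
    by_contra! hcz
    have hz' : z ∈ closedBall (0 : ℂ) ‖z₁‖ := by
      simp only [mem_closedBall, dist_zero_right] at hz₀ ⊢
      linarith
    exact absurd (hmin (show z ∈ _ from ⟨hz', hcz⟩)) (not_le.2 hz)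
  have hne : z₀ ≠ 0 := by
    rintro rfl
    exact absurd h0 (not_lt.2 hc)
  refine ⟨z₀, hsub hz₀, hne, le_antisymm ?_ hc, hlt⟩
  have ht := tendsto_radial (hu.continuousAt (isOpen_ball.mem_nhds (hsub hz₀)))
  refine le_of_tendsto ht ?_
  filter_upwards [Ioo_mem_nhdsLT (show (0 : ℝ) < 1 by norm_num)] with t ht
  refine (hlt _ ?_).le
  rw [norm_mul, Complex.norm_real, Real.norm_of_nonneg ht.1.le]
  exact mul_lt_of_lt_one_left (norm_pos_iff.2 hne) ht.2

/-- Schwarz's lemma for functions with positive real part, normalised by `h 0 = 1`. -/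
lemma normSq_one_sub_le_of_re_pos {h : ℂ → ℂ} {R : ℝ} (hd : DifferentiableOn ℂ h (ball 0 R))
    (h0 : h 0 = 1) (hpos : ∀ z ∈ ball (0 : ℂ) R, 0 < (h z).re) {z : ℂ}
    (hz : z ∈ ball (0 : ℂ) R) :
    R ^ 2 * normSq (1 - h z) ≤ ‖z‖ ^ 2 * normSq (1 + h z) := by
  have hne : ∀ z ∈ ball (0 : ℂ) R, 1 + h z ≠ 0 := by
    intro z hz he
    have := hpos z hz
    have h2 := congrArg Complex.re he
    simp at h2
    linarith
  have hR : 0 < R := pos_of_mem_ball hz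
  have hmaps : MapsTo (fun z => (1 - h z) / (1 + h z)) (ball 0 R)
      (ball ((fun z => (1 - h z) / (1 + h z)) 0) 1) := by
    intro w hw
    have hn : 0 < ‖1 + h w‖ := norm_pos_iff.2 (hne w hw)
    simp only [h0, sub_self, zero_div, mem_ball, dist_zero_right, norm_div]
    rw [div_lt_one hn, ← sq_lt_sq₀ (norm_nonneg _) (norm_nonneg _), ← normSq_eq_norm_sq,
      ← normSq_eq_norm_sq, normSq_apply, normSq_apply]
    have := hpos w hw
    simp
    nlinarith
  have hdist := Complex.dist_le_div_mul_dist_of_mapsTo_ball (f := fun z => (1 - h z) / (1 + h z))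
    (DifferentiableOn.div (by fun_prop) (by fun_prop) hne) (hmaps.mono_right ball_subset_closedBall) hz
  have hn : 0 < ‖1 + h z‖ := norm_pos_iff.2 (hne z hz)
  simp only [h0, sub_self, zero_div, dist_zero_right, norm_div] at hdist
  rw [div_mul_eq_mul_div, one_mul, div_le_div_iff₀ hn hR] at hdist
  rw [normSq_eq_norm_sq, normSq_eq_norm_sq, ← mul_pow, ← mul_pow]
  gcongr ?_ ^ 2
  linarith

/-- Boundary behaviour (Jack's lemma) at the first point where the real part vanishes. -/
lemma mul_deriv_of_first_re_eq_zero {h : ℂ → ℂ} (hd : DifferentiableOn ℂ h (ball 0 1))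
    (h0 : h 0 = 1) {z₀ : ℂ} (hz₀ : z₀ ∈ ball (0 : ℂ) 1) (hne : z₀ ≠ 0)
    (hpos : ∀ z, ‖z‖ < ‖z₀‖ → 0 < (h z).re) (hre : (h z₀).re = 0) :
    (z₀ * deriv h z₀).im = 0 ∧ (z₀ * deriv h z₀).re ≤ -(1 + (h z₀).im ^ 2) / 2 := by
  have hz₀' : ‖z₀‖ < 1 := by simpa using hz₀
  have hn0 : 0 < ‖z₀‖ := norm_pos_iff.2 hne
  have hder : HasDerivAt h (deriv h z₀) z₀ :=
    (hd.differentiableAt (isOpen_ball.mem_nhds hz₀)).hasDerivAt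
  constructor
  · have hc : HasDerivAt (fun θ : ℝ => z₀ * Complex.exp (θ * I)) (z₀ * I) 0 := by
      have h1 : HasDerivAt (fun θ : ℝ => (θ : ℂ) * I) I 0 := by
        simpa using (Complex.ofRealCLM.hasDerivAt (x := (0 : ℝ))).mul_const I
      simpa using (h1.cexp).const_mul z₀
    have hx : HasDerivAt (fun θ : ℝ => h (z₀ * Complex.exp (θ * I))) (deriv h z₀ * (z₀ * I)) 0 :=
      HasDerivAt.comp (𝕜 := ℝ) (𝕜' := ℂ) (0 : ℝ) (by simpa using hder) hc
    have hxre : HasDerivAt (fun θ : ℝ => (h (z₀ * Complex.exp (θ * I))).re)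
        (deriv h z₀ * (z₀ * I)).re 0 := Complex.reCLM.hasFDerivAt.comp_hasDerivAt (0 : ℝ) hx
    have hnn : ∀ w ∈ closedBall (0 : ℂ) ‖z₀‖, 0 ≤ (h w).re := by
      intro w hw
      have hc : ContinuousAt h w := hd.continuousOn.continuousAt
        (isOpen_ball.mem_nhds (closedBall_subset_ball hz₀' hw))
      refine ge_of_tendsto (tendsto_radial (u := fun z => (h z).re) (by fun_prop)) ?_
      filter_upwards [Ioo_mem_nhdsLT (show (0 : ℝ) < 1 by norm_num)] with t ht
      refine (hpos _ ?_).le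
      rw [norm_mul, Complex.norm_real, Real.norm_of_nonneg ht.1.le]
      have : ‖w‖ ≤ ‖z₀‖ := by simpa using hw
      nlinarith [ht.1, ht.2, norm_nonneg w]
    have hmin : IsLocalMin (fun θ : ℝ => (h (z₀ * Complex.exp (θ * I))).re) 0 := by
      refine Eventually.of_forall fun θ => ?_
      simp only [ofReal_zero, zero_mul, Complex.exp_zero, mul_one, hre]
      apply hnn
      simp [Complex.norm_exp_ofReal_mul_I]
    have := hmin.hasDerivAt_eq_zero hxre
    simp at this ⊢
    linarith
  · have hc : HasDerivAt (fun t : ℝ => (t : ℂ) * z₀) z₀ 1 := by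
      simpa using (Complex.ofRealCLM.hasDerivAt (x := (1 : ℝ))).mul_const z₀
    have hx : HasDerivAt (fun t : ℝ => h (t * z₀)) (deriv h z₀ * z₀) 1 :=
      HasDerivAt.comp (𝕜 := ℝ) (𝕜' := ℂ) (1 : ℝ) (by simpa using hder) hc
    have hxre : HasDerivAt (fun t : ℝ => (h (t * z₀)).re) (deriv h z₀ * z₀).re 1 :=
      Complex.reCLM.hasFDerivAt.comp_hasDerivAt (1 : ℝ) hx
    have hxim : HasDerivAt (fun t : ℝ => (h (t * z₀)).im) (deriv h z₀ * z₀).im 1 :=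
      Complex.imCLM.hasFDerivAt.comp_hasDerivAt (1 : ℝ) hx
    have hψ := ((hasDerivAt_id (1 : ℝ)).pow 2).mul (((hxre.const_add 1).pow 2).add (hxim.pow 2))
      |>.sub (((hxre.const_sub 1).pow 2).add (hxim.pow 2))
    have hmin := (hasDerivWithinAt_iff_tendsto_slope' (by simp)).1 (hψ.hasDerivWithinAt (s := Iio 1))
    have := le_of_tendsto (b := (0 : ℝ)) hmin ?_
    · simp [hre] at this
      rw [mul_comm]
      simp
      linarith
    filter_upwards [Ioo_mem_nhdsLT (show (0 : ℝ) < 1 by norm_num)] with t ht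
    have hS := normSq_one_sub_le_of_re_pos (hd.mono (ball_subset_ball hz₀'.le)) h0
      (fun z hz => hpos z (by simpa using hz)) (z := t * z₀) (by
        simp only [mem_ball, dist_zero_right]
        rw [norm_mul, Complex.norm_real, Real.norm_of_nonneg ht.1.le]
        exact mul_lt_of_lt_one_left hn0 ht.2)
    rw [norm_mul, Complex.norm_real, Real.norm_of_nonneg ht.1.le, mul_pow, mul_comm (t ^ 2),
      mul_assoc, mul_le_mul_iff_right₀ (by positivity), normSq_apply, normSq_apply] at hS
    rw [slope_def_field]
    apply div_nonpos_of_nonneg_of_nonpos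
    · simp [hre] at hS ⊢
      nlinarith
    · linarith [ht.2]

/-- Nunokawa's lemma for `exp ∘ L`. -/
lemma exists_mul_deriv_eq_of_first_im_eq {L : ℂ → ℂ} {γ : ℝ} (hγ : 0 < γ)
    (hd : DifferentiableOn ℂ L (ball 0 1)) (h0 : L 0 = 0) {z₀ : ℂ}
    (hz₀ : z₀ ∈ ball (0 : ℂ) 1) (hne : z₀ ≠ 0)
    (hlt : ∀ z, ‖z‖ < ‖z₀‖ → |(L z).im| < γ * (π / 2)) (him : (L z₀).im = γ * (π / 2)) :
    ∃ K : ℝ, 1 ≤ K ∧ z₀ * deriv L z₀ = γ * K * I := by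
  set a : ℝ := Real.exp ((L z₀).re / γ) with ha
  have ha0 : 0 < a := Real.exp_pos _
  have hre : ∀ z, (Complex.exp (L z / γ)).re = Real.exp ((L z).re / γ) * Real.cos ((L z).im / γ) := by
    intro z
    rw [Complex.exp_re, Complex.div_ofReal_re, Complex.div_ofReal_im]
  have hπ : (L z₀).im / γ = π / 2 := by rw [him]; field_simp
  have hval : Complex.exp (L z₀ / γ) = a * I := by
    apply Complex.ext
    · rw [hre, hπ]; simp
    · rw [Complex.exp_im, Complex.div_ofReal_re, Complex.div_ofReal_im, hπ,
        Real.sin_pi_div_two, mul_one, ← ha, Complex.mul_I_im, Complex.ofReal_re]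
  have hder : HasDerivAt (fun z => Complex.exp (L z / γ))
      (Complex.exp (L z₀ / γ) * (deriv L z₀ / γ)) z₀ :=
    ((hd.differentiableAt (isOpen_ball.mem_nhds hz₀)).hasDerivAt.div_const _).cexp
  obtain ⟨h1, h2⟩ := mul_deriv_of_first_re_eq_zero (h := fun z => Complex.exp (L z / γ))
    (by fun_prop) (by simp [h0]) hz₀ hne (fun z hz => by
      rw [hre]
      refine mul_pos (Real.exp_pos _) (Real.cos_pos_of_mem_Ioo ?_)
      have := abs_lt.1 (hlt z hz)
      constructor
      · rw [lt_div_iff₀ hγ]; linarith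
      · rw [div_lt_iff₀ hγ]; linarith) (by rw [hre, hπ]; simp)
  have hmul : z₀ * deriv (fun z => Complex.exp (L z / γ)) z₀
      = ((a / γ : ℝ) : ℂ) * (I * (z₀ * deriv L z₀)) := by
    rw [hder.deriv, hval]; push_cast; ring
  have him' : (Complex.exp (L z₀ / γ)).im = a := by rw [hval]; simp
  rw [hmul, Complex.im_ofReal_mul, Complex.I_mul_im] at h1
  rw [hmul, him', Complex.re_ofReal_mul, Complex.I_mul_re] at h2
  have h1' : (z₀ * deriv L z₀).re = 0 := by
    rcases mul_eq_zero.1 h1 with h | h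
    · exact absurd h (by positivity)
    · exact h
  refine ⟨(z₀ * deriv L z₀).im / γ, ?_, ?_⟩
  · rw [div_mul_eq_mul_div, div_le_iff₀ hγ] at h2
    rw [le_div_iff₀ hγ, one_mul]
    by_contra! hc
    nlinarith [mul_nonneg hγ.le (sq_nonneg (a - 1)), mul_lt_mul_of_pos_left hc ha0]
  · have hγ' : (γ : ℂ) ≠ 0 := by exact_mod_cast hγ.ne'
    apply Complex.ext
    · rw [h1']; simp
    · push_cast
      rw [mul_div_cancel₀ _ hγ']
      simp

lemma arg_one_add_ofReal_mul_I (y : ℝ) : Complex.arg (1 + y * I) = Real.arctan y := by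
  have h : |Complex.arg (1 + y * I)| < π / 2 :=
    Complex.abs_arg_lt_pi_div_two_iff.2 (Or.inl (by simp))
  have ht : Real.tan (Complex.arg (1 + y * I)) = y := by simp [Complex.tan_arg]
  rw [← Real.arctan_tan (abs_lt.1 h).1 (abs_lt.1 h).2, ht]

/-- A holomorphic function on the disc with nonnegative real part, positive at the origin,
has positive real part everywhere. -/
lemma re_pos_of_re_nonneg {F : ℂ → ℂ} (hd : DifferentiableOn ℂ F (ball 0 1))
    (hnn : ∀ z ∈ ball (0 : ℂ) 1, 0 ≤ (F z).re) (h0 : 0 < (F 0).re) {z : ℂ}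
    (hz : z ∈ ball (0 : ℂ) 1) : 0 < (F z).re := by
  refine (hnn z hz).lt_of_ne fun he => ?_
  have hmax : IsMaxOn (norm ∘ fun w => Complex.exp (-F w)) (ball (0 : ℂ) 1) z := by
    intro w hw
    simpa [Complex.norm_exp, ← he] using hnn w hw
  have := Complex.norm_eqOn_of_isPreconnected_of_isMaxOn
    (convex_ball (0 : ℂ) 1).isPreconnected isOpen_ball (by fun_prop) hz hmax
    (mem_ball_self one_pos)
  simp [Complex.norm_exp, ← he] at this
  linarith

lemma re_pos_of_re_add_mul_deriv_pos {g : ℂ → ℂ} (hd : DifferentiableOn ℂ g (ball 0 1))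
    (h0 : g 0 = 1) (hpos : ∀ z ∈ ball (0 : ℂ) 1, 0 < (g z + z * deriv g z).re) {z : ℂ}
    (hz : z ∈ ball (0 : ℂ) 1) : 0 < (g z).re := by
  by_contra! hc
  have := hd.continuousOn
  obtain ⟨z₀, hz₀, hne, he, hlt⟩ := exists_first_point (u := fun z => -(g z).re)
    (by fun_prop) (c := 0) (by simp [h0]) hz (by linarith)
  obtain ⟨-, h2⟩ := mul_deriv_of_first_re_eq_zero hd h0 hz₀ hne
    (fun z hz => by linarith [hlt z hz]) (by linarith)
  have := hpos z₀ hz₀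
  rw [Complex.add_re] at this
  nlinarith [sq_nonneg (g z₀).im]

lemma abs_arg_lt_of_abs_arg_add_mul_deriv_lt {g : ℂ → ℂ} {γ : ℝ} (hγ : 0 < γ) (hγ1 : γ ≤ 1)
    (hd : DifferentiableOn ℂ g (ball 0 1)) (h0 : g 0 = 1)
    (hpos : ∀ z ∈ ball (0 : ℂ) 1, 0 < (g z).re)
    (harg : ∀ z ∈ ball (0 : ℂ) 1,
      |Complex.arg (g z + z * deriv g z)| < γ * (π / 2) + Real.arctan γ)
    {z : ℂ} (hz : z ∈ ball (0 : ℂ) 1) : |Complex.arg (g z)| < γ * (π / 2) := by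
  by_contra! hc
  have hslit : ∀ z ∈ ball (0 : ℂ) 1, g z ∈ slitPlane := fun z hz => Or.inl (hpos z hz)
  set L : ℂ → ℂ := fun z => Complex.log (g z) with hL
  have hLd : DifferentiableOn ℂ L (ball 0 1) := hd.clog hslit
  have hLim : ∀ z, (L z).im = Complex.arg (g z) := fun z => Complex.log_im _
  have hL0 : L 0 = 0 := by simp [hL, h0]
  have := hLd.continuousOn
  have hpi := Real.pi_pos
  obtain ⟨z₀, hz₀, hne, he, hlt⟩ := exists_first_point (u := fun z => |(L z).im|)
    (by fun_prop) (c := γ * (π / 2)) (by simp [hL0]; positivity) hz (by simpa [hLim] using hc)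
  have hg0 : g z₀ ≠ 0 := fun h => by simpa [h] using hpos z₀ hz₀
  have hLder : deriv L z₀ = deriv g z₀ / g z₀ :=
    ((hd.differentiableAt (isOpen_ball.mem_nhds hz₀)).hasDerivAt.clog (hslit z₀ hz₀)).deriv
  have key : ∀ y : ℝ, z₀ * deriv L z₀ = y * I →
      Complex.arg (g z₀) + Real.arctan y ∈ Ioc (-π) π →
      Complex.arg (g z₀ + z₀ * deriv g z₀) = Complex.arg (g z₀) + Real.arctan y := by
    intro y hy hmem
    have : g z₀ + z₀ * deriv g z₀ = g z₀ * (1 + y * I) := by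
      rw [← hy, hLder]; field_simp
    rw [this, Complex.arg_mul hg0 _ (by rwa [arg_one_add_ofReal_mul_I]), arg_one_add_ofReal_mul_I]
    intro h
    have := congrArg Complex.re h
    simp at this
  have hA := harg z₀ hz₀
  rcases (abs_eq (by positivity)).1 he with h | h
  · obtain ⟨K, hK, hKe⟩ := exists_mul_deriv_eq_of_first_im_eq hγ hLd hL0 hz₀ hne hlt h
    rw [hLim] at h
    have h1 := Real.arctan_lt_pi_div_two (γ * K)
    have h2 : Real.arctan γ ≤ Real.arctan (γ * K) := Real.arctan_mono (by nlinarith)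
    have h3 := Real.arctan_pos.2 hγ
    rw [key (γ * K) (by rw [hKe]; push_cast; ring)
      ⟨by rw [h]; nlinarith, by rw [h]; nlinarith⟩, h] at hA
    linarith [le_abs_self (γ * (π / 2) + Real.arctan (γ * K))]
  · obtain ⟨K, hK, hKe⟩ := exists_mul_deriv_eq_of_first_im_eq (L := fun z => -L z) hγ hLd.neg
      (by simp [hL0]) hz₀ hne (by simpa using hlt) (by simp [h])
    rw [hLim] at h
    have h1 := Real.neg_pi_div_two_lt_arctan (-(γ * K))
    have h2 : Real.arctan (-(γ * K)) ≤ -Real.arctan γ := by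
      rw [← Real.arctan_neg]
      exact Real.arctan_mono (by nlinarith)
    have h3 := Real.arctan_pos.2 hγ
    have hKe' : z₀ * deriv L z₀ = (-(γ * K) : ℝ) * I := by
      rw [deriv.fun_neg] at hKe
      push_cast
      linear_combination -hKe
    rw [key _ hKe' ⟨by rw [h]; nlinarith, by rw [h]; nlinarith⟩, h] at hA
    linarith [neg_le_abs (-(γ * (π / 2)) + Real.arctan (-(γ * K)))]

/-- Descent step: if `U = m V + z V'` and `W = (m - 1) U + z U'`, then `Re (W / U) > 0`
implies `Re (U / V) > 0`. -/
lemma re_div_pos_of_re_div_pos {U V W : ℂ → ℂ} {m : ℝ} (hm : 0 < m)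
    (hUd : DifferentiableOn ℂ U (ball 0 1)) (hVd : DifferentiableOn ℂ V (ball 0 1))
    (hU : ∀ z ∈ ball (0 : ℂ) 1, U z = m * V z + z * deriv V z)
    (hW : ∀ z ∈ ball (0 : ℂ) 1, W z = (m - 1) * U z + z * deriv U z)
    (hpos : ∀ z ∈ ball (0 : ℂ) 1, 0 < (W z / U z).re) {z : ℂ} (hz : z ∈ ball (0 : ℂ) 1) :
    0 < (U z / V z).re := by
  have hU0 : ∀ z ∈ ball (0 : ℂ) 1, U z ≠ 0 := fun z hz h => by simpa [h] using hpos z hz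
  have hb0 : (0 : ℂ) ∈ ball (0 : ℂ) 1 := mem_ball_self one_pos
  set h : ℂ → ℂ := fun z => m * V z / U z with hh
  have hd : DifferentiableOn ℂ h (ball 0 1) := (hVd.const_mul _).div hUd hU0
  have h0 : h 0 = 1 := by
    have h1 := hU 0 hb0
    simp only [zero_mul, add_zero] at h1
    simp only [hh, ← h1]
    exact div_self (hU0 0 hb0)
  have hmain : ∀ z ∈ ball (0 : ℂ) 1, 0 < (h z).re := by
    intro z hz
    by_contra! hc
    have := hd.continuousOn
    obtain ⟨z₀, hz₀, hne, he, hlt⟩ := exists_first_point (u := fun z => -(h z).re)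
      (by fun_prop) (c := 0) (by simp [h0]) hz (by linarith)
    have hre : (h z₀).re = 0 := by linarith
    obtain ⟨h1, h2⟩ := mul_deriv_of_first_re_eq_zero hd h0 hz₀ hne
      (fun z hz => by linarith [hlt z hz]) hre
    have hnb := isOpen_ball.mem_nhds hz₀
    have hUz := hU0 z₀ hz₀
    have heq : z₀ * deriv h z₀ = m - h z₀ * (1 + W z₀ / U z₀) := by
      rw [(((hVd.differentiableAt hnb).hasDerivAt.const_mul (m : ℂ)).fun_div
        (hUd.differentiableAt hnb).hasDerivAt hUz).deriv]
      simp only [hh]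
      field_simp
      linear_combination (-m * U z₀ : ℂ) * hU z₀ hz₀ + (m * V z₀) * hW z₀ hz₀
    have hP := hpos z₀ hz₀
    rw [heq] at h1 h2
    simp only [sub_im, ofReal_im, mul_im, add_im, one_im, add_re, one_re, hre] at h1
    have him : (h z₀).im = 0 := by
      have h3 : (h z₀).im * (1 + (W z₀ / U z₀).re) = 0 := by linarith
      rcases mul_eq_zero.1 h3 with h | h
      · exact h
      · linarith
    simp only [sub_re, ofReal_re, mul_re, hre, him] at h2
    linarith
  have hz1 := hmain z hz
  have hq : U z / V z = m * (h z)⁻¹ := by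
    have : (m : ℂ) ≠ 0 := by exact_mod_cast hm.ne'
    simp only [hh, inv_div]
    rw [mul_div_assoc', mul_div_mul_left _ _ this]
  rw [hq, Complex.re_ofReal_mul, Complex.inv_re]
  have : 0 < normSq (h z) := normSq_pos.2 fun h' => by simp [h'] at hz1
  positivity

/-- If `f z = z ^ p * u z` then `iteratedDeriv k f z = z ^ (p - k) * derivFactor p u k z`. -/
noncomputable def derivFactor (p : ℕ) (u : ℂ → ℂ) : ℕ → ℂ → ℂ
  | 0 => u
  | k + 1 => fun z => ((p : ℂ) - k) * derivFactor p u k z + z * deriv (derivFactor p u k) z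

lemma differentiableOn_derivFactor (p : ℕ) {u : ℂ → ℂ} (hu : DifferentiableOn ℂ u (ball 0 1))
    (k : ℕ) : DifferentiableOn ℂ (derivFactor p u k) (ball 0 1) := by
  induction k with
  | zero => exact hu
  | succ k ih => exact (ih.const_mul _).add (differentiableOn_id.mul (ih.deriv isOpen_ball))

lemma derivFactor_zero_ne_zero (p : ℕ) {u : ℂ → ℂ} (hu : u 0 ≠ 0) {k : ℕ} (hk : k ≤ p) :
    derivFactor p u k 0 ≠ 0 := by
  induction k with
  | zero => exact hu
  | succ k ih =>
    have : (p : ℂ) - k ≠ 0 := sub_ne_zero.2 (by exact_mod_cast (by omega : p ≠ k))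
    simpa [derivFactor, this] using ih (by omega)

lemma iteratedDeriv_eq_pow_mul_derivFactor {p : ℕ} {f u : ℂ → ℂ}
    (hu : DifferentiableOn ℂ u (ball 0 1)) (hf : ∀ z ∈ ball (0 : ℂ) 1, f z = z ^ p * u z)
    {k : ℕ} (hk : k ≤ p) : ∀ z ∈ ball (0 : ℂ) 1,
      iteratedDeriv k f z = z ^ (p - k) * derivFactor p u k z := by
  induction k with
  | zero => simpa [derivFactor] using hf
  | succ k ih =>
    intro z hz
    have hev : iteratedDeriv k f =ᶠ[𝓝 z] fun z => z ^ (p - k) * derivFactor p u k z :=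
      Filter.eventually_of_mem (isOpen_ball.mem_nhds hz) (ih (by omega))
    have hd := ((differentiableOn_derivFactor p hu k).differentiableAt
      (isOpen_ball.mem_nhds hz)).hasDerivAt
    rw [iteratedDeriv_succ, hev.deriv_eq, ((hasDerivAt_pow (p - k) z).fun_mul hd).deriv]
    obtain ⟨m, rfl⟩ : ∃ m, p = k + 1 + m := ⟨p - (k + 1), by omega⟩
    rw [show k + 1 + m - k = m + 1 by omega, show k + 1 + m - (k + 1) = m by omega]
    simp only [derivFactor, Nat.add_sub_cancel]
    push_cast
    ring

lemma exists_eq_pow_mul {f : ℂ → ℂ} (hf : DifferentiableOn ℂ f (ball 0 1)) (p : ℕ)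
    (hf0 : ∀ k < p, iteratedDeriv k f 0 = 0) :
    ∃ u : ℂ → ℂ, DifferentiableOn ℂ u (ball 0 1) ∧ ∀ z ∈ ball (0 : ℂ) 1, f z = z ^ p * u z := by
  induction p with
  | zero => exact ⟨f, hf, by simp⟩
  | succ p ih =>
    obtain ⟨u, hu, hfu⟩ := ih fun k hk => hf0 k (by omega)
    have hb0 : (0 : ℂ) ∈ ball (0 : ℂ) 1 := mem_ball_self one_pos
    have hu0 : u 0 = 0 := by
      by_contra hne
      have := iteratedDeriv_eq_pow_mul_derivFactor hu hfu le_rfl 0 hb0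
      rw [hf0 p (by omega)] at this
      exact derivFactor_zero_ne_zero p hne le_rfl (by simpa using this.symm)
    refine ⟨dslope u 0, (Complex.differentiableOn_dslope (isOpen_ball.mem_nhds hb0)).2 hu, ?_⟩
    intro z hz
    have := sub_smul_dslope u 0 z
    simp only [sub_zero, hu0, smul_eq_mul] at this
    rw [hfu z hz, ← this]
    ring

lemma re_add_mul_deriv_div_pos {g : ℂ → ℂ} {γ : ℝ} (hγ : 0 < γ)
    (hroot : 2 * γ + (2 / π) * Real.arctan γ = 1)
    (hd : DifferentiableOn ℂ g (ball 0 1)) (h0 : g 0 = 1)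
    (harg : ∀ z ∈ ball (0 : ℂ) 1,
      |Complex.arg (g z + z * deriv g z)| < (π / 2) * (γ + (2 / π) * Real.arctan γ))
    {z : ℂ} (hz : z ∈ ball (0 : ℂ) 1) : 0 < ((g z + z * deriv g z) / g z).re := by
  have hpi := Real.pi_pos
  have harctan := Real.arctan_pos.2 hγ
  have hsum : γ * π + Real.arctan γ = π / 2 := by
    field_simp at hroot
    linarith
  have hbound : (π / 2) * (γ + (2 / π) * Real.arctan γ) = γ * (π / 2) + Real.arctan γ := by
    field_simp
  simp only [hbound] at harg
  have hγ1 : γ ≤ 1 := by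
    by_contra! hc
    nlinarith
  have hγπ : 0 < γ * π := by positivity
  have hUd : DifferentiableOn ℂ (fun z => g z + z * deriv g z) (ball 0 1) :=
    hd.add (differentiableOn_id.mul (hd.deriv isOpen_ball))
  have hUpos : ∀ z ∈ ball (0 : ℂ) 1, 0 < (g z + z * deriv g z).re := by
    refine fun z hz => re_pos_of_re_nonneg hUd (fun w hw => ?_) (by simp [h0]) hz
    exact Complex.abs_arg_le_pi_div_two_iff.1 (by linarith [harg w hw])
  have hgpos : ∀ z ∈ ball (0 : ℂ) 1, 0 < (g z).re :=
    fun z hz => re_pos_of_re_add_mul_deriv_pos hd h0 hUpos hz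
  have hA := abs_lt.1 (harg z hz)
  have hB := abs_lt.1 (abs_arg_lt_of_abs_arg_add_mul_deriv_lt hγ hγ1 hd h0 hgpos harg hz)
  have hU0 : g z + z * deriv g z ≠ 0 := fun h => by simpa [h] using hUpos z hz
  have hg0 : g z ≠ 0 := fun h => by simpa [h] using hgpos z hz
  have hinv : Complex.arg (g z)⁻¹ = -Complex.arg (g z) := by
    rw [Complex.arg_inv, if_neg (by linarith)]
  have hdiv : Complex.arg ((g z + z * deriv g z) / g z)
      = Complex.arg (g z + z * deriv g z) - Complex.arg (g z) := by
    rw [div_eq_mul_inv, Complex.arg_mul hU0 (inv_ne_zero hg0), hinv, sub_eq_add_neg]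
    rw [hinv]
    constructor <;> linarith
  have hlt : |Complex.arg ((g z + z * deriv g z) / g z)| < π / 2 := by
    rw [hdiv, abs_lt]
    constructor <;> linarith
  exact (Complex.abs_arg_lt_pi_div_two_iff.1 hlt).resolve_right (div_ne_zero hU0 hg0)

/-- Let `γ₀ > 0` satisfy `2γ₀ + (2/π)·arctan γ₀ = 1`. If
`f(z) = z^p + ⋯` is analytic in the unit disc and
`|arg f^{(p)}(z)| < (π/2)(γ₀ + (2/π)·arctan γ₀)` on the disc, then
`|arg(z·f'(z)/f(z))| < π/2` on the punctured disc; in particular `f` is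
`p`-valently starlike, i.e. `Re(z·f'(z)/f(z)) > 0` there. -/
theorem stmt_4 (γ₀ : ℝ) (hγ₀ : 0 < γ₀)
    (hroot : 2 * γ₀ + (2 / Real.pi) * Real.arctan γ₀ = 1)
    (p : ℕ) (hp : 1 ≤ p) (f : ℂ → ℂ)
    (hf : AnalyticOnNhd ℂ f {z : ℂ | ‖z‖ < 1})
    (hf0 : ∀ k < p, iteratedDeriv k f 0 = 0)
    (hfp : iteratedDeriv p f 0 = (p.factorial : ℂ))
    (harg : ∀ z : ℂ, ‖z‖ < 1 →
      |Complex.arg (iteratedDeriv p f z)| <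
        (Real.pi / 2) * (γ₀ + (2 / Real.pi) * Real.arctan γ₀)) :
    ∀ z : ℂ, ‖z‖ < 1 → z ≠ 0 →
      |Complex.arg (z * deriv f z / f z)| < Real.pi / 2 ∧
        0 < (z * deriv f z / f z).re := by
  have hball : {z : ℂ | ‖z‖ < 1} = ball (0 : ℂ) 1 := by ext; simp
  have hb0 : (0 : ℂ) ∈ ball (0 : ℂ) 1 := mem_ball_self one_pos
  have hfd : DifferentiableOn ℂ f (ball 0 1) := hball ▸ hf.differentiableOn
  obtain ⟨u, hu, hfu⟩ := exists_eq_pow_mul hfd p hf0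
  have hvd := differentiableOn_derivFactor p hu
  obtain ⟨q, rfl⟩ : ∃ q, p = q + 1 := ⟨p - 1, by omega⟩
  set v := derivFactor (q + 1) u with hv
  have hvp : ∀ z ∈ ball (0 : ℂ) 1, iteratedDeriv (q + 1) f z = v (q + 1) z := fun z hz => by
    simpa using iteratedDeriv_eq_pow_mul_derivFactor hu hfu le_rfl z hz
  have hvq : ∀ z, v (q + 1) z = v q z + z * deriv (v q) z := fun z => by
    simp [hv, derivFactor]
  have hc : (0 : ℝ) < ((q + 1).factorial : ℝ)⁻¹ := by positivity
  have htop : ∀ z ∈ ball (0 : ℂ) 1, 0 < (v (q + 1) z / v q z).re := by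
    intro z hz
    set c : ℝ := ((q + 1).factorial : ℝ)⁻¹ with hcdef
    have hc0 : (c : ℂ) ≠ 0 := by exact_mod_cast hc.ne'
    have hsum : ∀ z ∈ ball (0 : ℂ) 1,
        c * v q z + z * deriv (fun z => c * v q z) z = c * v (q + 1) z := fun z hz => by
      rw [deriv_const_mul _ ((hvd q).differentiableAt (isOpen_ball.mem_nhds hz)), hvq]
      ring
    have h0 : (c : ℂ) * v q 0 = 1 := by
      have h1 := hvq 0
      rw [← hvp 0 hb0, hfp, zero_mul, add_zero] at h1
      rw [← h1, hcdef]
      push_cast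
      exact inv_mul_cancel₀ (by exact_mod_cast (q + 1).factorial_ne_zero)
    have := re_add_mul_deriv_div_pos (g := fun z => c * v q z) hγ₀ hroot
      ((hvd q).const_mul _) h0 (fun w hw => by
        rw [hsum w hw, Complex.arg_real_mul _ hc, ← hvp w hw]
        exact harg w (by simpa using hw)) hz
    rwa [hsum z hz, mul_div_mul_left _ _ hc0] at this
  have hall : ∀ j k, k + j = q → ∀ z ∈ ball (0 : ℂ) 1, 0 < (v (k + 1) z / v k z).re := by
    intro j
    induction j with
    | zero => rintro k rfl; exact htop
    | succ j ih =>
      intro k hk z hz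
      have hm : (0 : ℝ) < ((q + 1 : ℕ) : ℝ) - k := sub_pos.2 (by exact_mod_cast (by omega))
      refine re_div_pos_of_re_div_pos hm (hvd (k + 1)) (hvd k) (fun z _ => ?_) (fun z _ => ?_)
        (ih (k + 1) (by omega)) hz
      · simp [hv, derivFactor]
      · simp only [hv, derivFactor]
        push_cast
        ring
  intro z hz hz0
  have hz' : z ∈ ball (0 : ℂ) 1 := by simpa using hz
  have heq : z * deriv f z / f z = v 1 z / v 0 z := by
    have h1 := iteratedDeriv_eq_pow_mul_derivFactor hu hfu (k := 1) (by omega) z hz'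
    rw [iteratedDeriv_one, Nat.add_sub_cancel] at h1
    rw [h1, hfu z hz', ← mul_assoc, ← pow_succ', mul_div_mul_left _ _ (pow_ne_zero _ hz0)]
    rfl
  have hpos := hall q 0 (by omega) z hz'
  rw [heq]
  exact ⟨Complex.abs_arg_lt_pi_div_two_iff.2 (Or.inl hpos), hpos⟩
end

section
/- Let p ≥ 1 be an integer and let f(z) = z^p + ∑_{n=p+1}^∞ a_n z^n be analytic in the open unit disc 𝔻. Let α₀ ∈ (0, 3/2] and let α : {0,1,…,p} → ℝ be the sequence of positive reals determined by α_0 = α₀ and α_k + (2/π)·arctan(α_k / k) = α_{k-1} for k = 1, …, p. If |arg f^{(p)}(z)| < π·α₀/2 for all z ∈ 𝔻, then for every k ∈ {1, …, p}, |arg( f^{(p-k)}(z)/z^k )| < π·α_k/2 for all z ∈ 𝔻, z ≠ 0. -/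
open Complex Real

lemma im_eq_zero_re_nonpos_of_forall_re_mul_nonneg {b : ℂ}
    (h : ∀ v : ℂ, v.re < 0 → 0 ≤ (v * b).re) : b.im = 0 ∧ b.re ≤ 0 := by
  have key : ∀ t : ℝ, 0 ≤ -b.re - t * b.im := fun t => by
    have := h ⟨-1, t⟩ (by simp)
    simpa [Complex.mul_re] using this
  refine ⟨?_, by simpa using key 0⟩
  by_contra hb
  have := key ((1 - b.re) / b.im)
  rw [div_mul_cancel₀ _ hb] at this
  linarith

lemma eventually_norm_mul_one_add_lt {z v : ℂ} (hz : z ≠ 0) (hv : v.re < 0) :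
    ∀ᶠ t : ℝ in nhdsWithin 0 (Set.Ioi 0), ‖z * (1 + t * v)‖ < ‖z‖ := by
  have hv0 : 0 < Complex.normSq v := Complex.normSq_pos.mpr (by rintro rfl; simp at hv)
  have hd : 0 < -2 * v.re / Complex.normSq v := div_pos (by linarith) hv0
  filter_upwards [Ioo_mem_nhdsGT hd] with t ht
  obtain ⟨ht0, ht1⟩ := ht
  rw [lt_div_iff₀ hv0, Complex.normSq_apply] at ht1
  have : ‖1 + (t : ℂ) * v‖ < 1 := by
    rw [← sq_lt_one_iff₀ (norm_nonneg _), ← Complex.normSq_eq_norm_sq, Complex.normSq_apply]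
    simp only [Complex.add_re, Complex.one_re, Complex.re_ofReal_mul, Complex.add_im,
      Complex.one_im, Complex.im_ofReal_mul]
    nlinarith
  rw [norm_mul]
  exact mul_lt_of_lt_one_right (norm_pos_iff.mpr hz) this

/-- If `F` has nonnegative real part on the ball of radius `‖z₀‖` and `Re F` vanishes at the
boundary point `z₀`, then `z₀ * F'(z₀)` is a nonpositive real number. -/
lemma mul_deriv_real_nonpos_of_re_nonneg {F : ℂ → ℂ} {F' z₀ : ℂ} (hz₀ : z₀ ≠ 0)
    (hF : HasDerivAt F F' z₀) (h0 : (F z₀).re = 0) (hpos : ∀ z, ‖z‖ < ‖z₀‖ → 0 ≤ (F z).re) :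
    (z₀ * F').im = 0 ∧ (z₀ * F').re ≤ 0 := by
  refine im_eq_zero_re_nonpos_of_forall_re_mul_nonneg fun v hv => ?_
  have hγ : HasDerivAt (fun t : ℂ => z₀ * (1 + t * v)) (z₀ * v) ((0 : ℝ) : ℂ) := by
    simpa using (((hasDerivAt_id ((0 : ℝ) : ℂ)).mul_const v).const_add 1).const_mul z₀
  have hF₂ : HasDerivAt F F' (z₀ * (1 + ((0 : ℝ) : ℂ) * v)) := by simpa using hF
  have hu := (HasDerivAt.comp (h₂ := F) ((0 : ℝ) : ℂ) hF₂ hγ).real_of_complex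
  have ht := hu.tendsto_slope_zero_right
  have := ge_of_tendsto ht (b := 0) (by
    filter_upwards [eventually_norm_mul_one_add_lt hz₀ hv, self_mem_nhdsWithin] with t h1 h2
    have h2 : 0 < t := h2
    have h3 := hpos _ h1
    simp only [zero_add, Function.comp, smul_eq_mul, Complex.ofReal_zero, zero_mul, add_zero,
      mul_one, h0, sub_zero]
    positivity)
  rw [show v * (z₀ * F') = F' * (z₀ * v) by ring]
  exact this

/-- **Jack's lemma**. -/
lemma jack {φ : ℂ → ℂ} {φ' z₀ : ℂ} (hz₀ : z₀ ≠ 0)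
    (hφ : DifferentiableOn ℂ φ (Metric.ball 0 ‖z₀‖)) (h0 : φ 0 = 0)
    (hmaps : ∀ z, ‖z‖ < ‖z₀‖ → ‖φ z‖ ≤ 1) (hd : HasDerivAt φ φ' z₀) (h1 : ‖φ z₀‖ = 1) :
    (z₀ * φ' / φ z₀).im = 0 ∧ 1 ≤ (z₀ * φ' / φ z₀).re := by
  have hφ0 : φ z₀ ≠ 0 := by rw [← norm_pos_iff, h1]; exact one_pos
  have hF : HasDerivAt (fun z => 1 - φ z / φ z₀ * z₀ / z)
      (-((φ' / φ z₀ * z₀ * z₀ - φ z₀ / φ z₀ * z₀ * 1) / z₀ ^ 2)) z₀ :=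
    (((hd.div_const _).mul_const z₀).div (hasDerivAt_id z₀) hz₀).const_sub 1
  have key := mul_deriv_real_nonpos_of_re_nonneg hz₀ hF (by field_simp; simp) (fun z hz => by
    have hs : ‖φ z‖ ≤ 1 / ‖z₀‖ * ‖z‖ := by
      have := Complex.dist_le_div_mul_dist_of_mapsTo_ball (f := φ) (c := 0) (R₁ := ‖z₀‖) (R₂ := 1)
        (z := z) hφ (fun w hw => by
          simpa [h0] using hmaps w (by simpa using hw)) (by simpa using hz)
      simpa [h0] using this
    have hn : ‖φ z / φ z₀ * z₀ / z‖ ≤ 1 := by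
      rw [norm_div, norm_mul, norm_div, h1, div_one]
      refine div_le_one_of_le₀ ?_ (norm_nonneg _)
      have h0 : 0 < ‖z₀‖ := norm_pos_iff.mpr hz₀
      calc _ ≤ 1 / ‖z₀‖ * ‖z‖ * ‖z₀‖ := by gcongr
        _ = ‖z‖ := by field_simp
    have := (Complex.re_le_norm _).trans hn
    simp only [Complex.sub_re, Complex.one_re]
    linarith)
  have e : z₀ * (-((φ' / φ z₀ * z₀ * z₀ - φ z₀ / φ z₀ * z₀ * 1) / z₀ ^ 2))
      = 1 - z₀ * φ' / φ z₀ := by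
    field_simp
    ring
  rw [e] at key
  simp only [Complex.sub_re, Complex.one_re, Complex.sub_im, Complex.one_im] at key
  constructor <;> linarith

/-- **Nunokawa's lemma**: at a boundary point where `arg g` first attains `± πβ/2`, the logarithmic
derivative of `g` is purely imaginary, of size at least `β`. -/
lemma nunokawa {g : ℂ → ℂ} {g' z₀ : ℂ} {β σ : ℝ} (hβ : 0 < β) (hσ : σ = 1 ∨ σ = -1) (hz₀ : z₀ ≠ 0)
    (hg : DifferentiableOn ℂ g (Metric.ball 0 ‖z₀‖)) (hd : HasDerivAt g g' z₀)
    (h0re : 0 < (g 0).re) (h0im : (g 0).im = 0)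
    (hsec : ∀ z, ‖z‖ < ‖z₀‖ → g z ∈ slitPlane ∧ |arg (g z)| < π / 2 * β)
    (hne : g z₀ ∈ slitPlane) (harg : arg (g z₀) = σ * (π / 2 * β)) :
    ∃ K : ℝ, β ≤ σ * K ∧ z₀ * g' = g z₀ * (K * I) := by
  have hβc : (β : ℂ) ≠ 0 := by exact_mod_cast hβ.ne'
  set h : ℂ → ℂ := fun z => exp (log (g z) / β) with hh
  set c : ℝ := Real.exp (Real.log (g 0).re / β) with hc
  have hcpos : 0 < c := Real.exp_pos _
  have hh0 : h 0 = c := by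
    have : g 0 = ((g 0).re : ℂ) := by apply Complex.ext <;> simp [h0im]
    simp only [hh, hc]
    rw [this, ← Complex.ofReal_log h0re.le]
    push_cast
    simp
  have hre : ∀ z, ‖z‖ < ‖z₀‖ → 0 < (h z).re := fun z hz => by
    have := abs_lt.mp (hsec z hz).2
    simp only [hh, Complex.exp_re, Complex.div_ofReal_re, Complex.div_ofReal_im, Complex.log_im]
    refine mul_pos (Real.exp_pos _) (Real.cos_pos_of_mem_Ioo ⟨?_, ?_⟩)
    · rw [lt_div_iff₀ hβ]; linarith
    · rw [div_lt_iff₀ hβ]; linarith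
  obtain ⟨y, hy0, hyσ, hhz⟩ : ∃ y : ℝ, y ≠ 0 ∧ 0 < σ * y ∧ h z₀ = y * I := by
    have e : h z₀ = ((Real.exp (Real.log ‖g z₀‖ / β) : ℝ) : ℂ) * exp (σ * (π / 2) * I) := by
      simp only [hh]
      rw [Complex.ofReal_exp, ← Complex.exp_add, Complex.log, harg]
      congr 1
      push_cast
      field_simp
    have hp := Real.exp_pos (Real.log ‖g z₀‖ / β)
    rcases hσ with rfl | rfl
    · refine ⟨Real.exp (Real.log ‖g z₀‖ / β), hp.ne', by simpa using hp, ?_⟩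
      rw [e, Complex.ofReal_one, one_mul, Complex.exp_pi_div_two_mul_I]
    · refine ⟨-Real.exp (Real.log ‖g z₀‖ / β), by simp, by simpa using hp, ?_⟩
      rw [e, show ((-1 : ℝ) : ℂ) * (π / 2) * I = -(π / 2 * I) by push_cast; ring, Complex.exp_neg,
        Complex.exp_pi_div_two_mul_I, Complex.inv_I]
      push_cast
      ring
  have hgne := Complex.slitPlane_ne_zero hne
  have hdh : HasDerivAt h (h z₀ * (g' / g z₀ / β)) z₀ := ((hd.clog hne).div_const _).cexp
  have hhd : DifferentiableOn ℂ h (Metric.ball 0 ‖z₀‖) :=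
    ((hg.clog fun z hz => (hsec z (by simpa using hz)).1).div_const _).cexp
  have hadd : ∀ z, 0 ≤ (h z).re → h z + c ≠ 0 := fun z hz hz0 => by
    have := congrArg Complex.re hz0
    simp only [Complex.add_re, Complex.ofReal_re, Complex.zero_re] at this
    linarith
  have hadd₀ : h z₀ + c ≠ 0 := hadd z₀ (by simp [hhz])
  have hnorm : ∀ z, 0 ≤ (h z).re → ‖h z - c‖ ≤ ‖h z + c‖ := fun z hz => by
    rw [← sq_le_sq₀ (norm_nonneg _) (norm_nonneg _), ← Complex.normSq_eq_norm_sq,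
      ← Complex.normSq_eq_norm_sq, Complex.normSq_apply, Complex.normSq_apply]
    simp
    nlinarith
  have hsub₀ : h z₀ - c ≠ 0 := fun h0 => by
    have := congrArg Complex.re h0
    simp [hhz] at this
    linarith
  have J := jack (φ := fun z => (h z - c) / (h z + c)) hz₀
    ((hhd.sub_const _).div (hhd.add_const _) fun z hz => hadd z (hre z (by simpa using hz)).le)
    (by simp [hh0])
    (fun z hz => by
      rw [norm_div]
      exact div_le_one_of_le₀ (hnorm z (hre z hz).le) (norm_nonneg _))
    ((hdh.sub_const _).div (hdh.add_const _) hadd₀)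
    (by
      rw [norm_div, div_eq_one_iff_eq (norm_ne_zero_iff.mpr hadd₀),
        ← sq_eq_sq₀ (norm_nonneg _) (norm_nonneg _), ← Complex.normSq_eq_norm_sq,
        ← Complex.normSq_eq_norm_sq, Complex.normSq_apply, Complex.normSq_apply]
      simp [hhz])
  set a : ℂ := _ with ha
  change a.im = 0 ∧ 1 ≤ a.re at J
  obtain ⟨J1, J2⟩ := J
  have hyc : 0 < y ^ 2 + c ^ 2 := by positivity
  have hac : a = (a.re : ℂ) := by apply Complex.ext <;> simp [J1]
  have hycc : (y : ℂ) ^ 2 + c ^ 2 ≠ 0 := by exact_mod_cast hyc.ne'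
  have hy0c : (y : ℂ) ≠ 0 := by exact_mod_cast hy0
  have hc0c : (c : ℂ) ≠ 0 := by exact_mod_cast hcpos.ne'
  refine ⟨β * a.re * ((y ^ 2 + c ^ 2) / (2 * c * y)), ?_, ?_⟩
  · have h1 : 1 ≤ σ * ((y ^ 2 + c ^ 2) / (2 * c * y)) := by
      have hσ2 : σ * σ = 1 := by rcases hσ with rfl | rfl <;> norm_num
      have : σ * ((y ^ 2 + c ^ 2) / (2 * c * y)) = ((σ * y) ^ 2 + c ^ 2) / (2 * c * (σ * y)) := by
        have hσ0 : σ ≠ 0 := by rintro rfl; simp at hσ2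
        field_simp
        linear_combination (y ^ 2 + c ^ 2 - y ^ 2) * hσ2
      rw [this, le_div_iff₀ (by positivity)]
      nlinarith [sq_nonneg (σ * y - c)]
    calc β = β * (1 * 1) := by ring
      _ ≤ β * (a.re * (σ * ((y ^ 2 + c ^ 2) / (2 * c * y)))) := by gcongr
      _ = _ := by ring
  · have h2 : (y * I + c : ℂ) * (y * I - c) = -(y ^ 2 + c ^ 2) := by
      linear_combination (y : ℂ) ^ 2 * Complex.I_sq
    have ha' : a * (g z₀ * β * ((y * I + c : ℂ) * (y * I - c))) = z₀ * g' * (2 * c * y * I) := by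
      rw [hhz] at ha hadd₀ hsub₀
      rw [ha]
      field_simp
      ring
    rw [h2, hac] at ha'
    push_cast
    field_simp
    linear_combination I * ha' + (2 * z₀ * g' * c * y) * Complex.I_sq

lemma arg_ofReal_add_mul_I {κ : ℝ} (hκ : 0 < κ) (K : ℝ) :
    arg ((κ : ℂ) + K * I) = Real.arctan (K / κ) := by
  have hre : ((κ : ℂ) + K * I).re = κ := by simp
  have him : ((κ : ℂ) + K * I).im = K := by simp
  have h := (Complex.abs_arg_lt_pi_div_two_iff (z := (κ : ℂ) + K * I)).mpr
    (Or.inl (by rw [hre]; exact hκ))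
  rw [← Real.arctan_tan (abs_lt.mp h).1 (abs_lt.mp h).2, Complex.tan_arg, hre, him]

/-- If `arg (κ g + z g')` is bounded by `πβ/2 + arctan (β/κ)` then `arg g` is bounded by `πβ/2`. -/
lemma sector_of_sector_mul_add_deriv {g : ℂ → ℂ} {β κ : ℝ} (hβ : 0 < β) (hβ1 : β ≤ 1) (hκ : 0 < κ)
    (hg : DifferentiableOn ℂ g (Metric.ball 0 1)) (h0re : 0 < (g 0).re) (h0im : (g 0).im = 0)
    (H : ∀ z, ‖z‖ < 1 → κ * g z + z * deriv g z ≠ 0 ∧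
      |arg (κ * g z + z * deriv g z)| < π / 2 * β + Real.arctan (β / κ)) :
    ∀ z, ‖z‖ < 1 → g z ∈ slitPlane ∧ |arg (g z)| < π / 2 * β := by
  have hπ := Real.pi_pos
  have hat := Real.arctan_lt_pi_div_two (β / κ)
  have hat0 := Real.arctan_pos.mpr (div_pos hβ hκ)
  have hβπ : π / 2 * β ≤ π / 2 := by nlinarith
  set S : Set ℂ := {w | w ∈ slitPlane ∧ |arg w| < π / 2 * β} with hS
  have hSo : IsOpen S := by
    rw [isOpen_iff_mem_nhds]
    rintro w ⟨hw1, hw2⟩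
    filter_upwards [isOpen_slitPlane.mem_nhds hw1,
      (Complex.continuousAt_arg hw1).abs.eventually_lt_const hw2] with x h1 h2 using ⟨h1, h2⟩
  by_contra! hcon
  obtain ⟨z₁, hz₁, hz₁'⟩ := hcon
  have hbad₁ : g z₁ ∈ Sᶜ := fun h => absurd h.2 (not_lt.mpr (hz₁' h.1))
  have hcont : ContinuousOn g (Metric.closedBall 0 ‖z₁‖) :=
    hg.continuousOn.mono (Metric.closedBall_subset_ball hz₁)
  have hclosed : IsClosed (Metric.closedBall 0 ‖z₁‖ ∩ g ⁻¹' Sᶜ) :=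
    hcont.preimage_isClosed_of_isClosed Metric.isClosed_closedBall hSo.isClosed_compl
  have hcomp : IsCompact (Metric.closedBall 0 ‖z₁‖ ∩ g ⁻¹' Sᶜ) :=
    (isCompact_closedBall 0 ‖z₁‖).of_isClosed_subset hclosed Set.inter_subset_left
  obtain ⟨z₀, ⟨hz₀b, hz₀S⟩, hmin⟩ := hcomp.exists_isMinOn ⟨z₁, by simp, hbad₁⟩
    continuous_norm.continuousOn
  have hz₀le : ‖z₀‖ ≤ ‖z₁‖ := by simpa using hz₀b
  have hz₀1 : ‖z₀‖ < 1 := hz₀le.trans_lt hz₁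
  have hin : ∀ z, ‖z‖ < ‖z₀‖ → g z ∈ S := fun z hz => by
    by_contra hzS
    have : ‖z₀‖ ≤ ‖z‖ := hmin ⟨by simpa using (hz.trans_le hz₀le).le, hzS⟩
    linarith
  have hz₀ : z₀ ≠ 0 := by
    rintro rfl
    refine hz₀S ⟨Or.inl h0re, ?_⟩
    rw [Complex.arg_eq_zero_iff.mpr ⟨h0re.le, h0im⟩]
    simp only [abs_zero]
    positivity
  have hdiff : DifferentiableAt ℂ g z₀ :=
    hg.differentiableAt (Metric.isOpen_ball.mem_nhds (by simpa using hz₀1))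
  have hd := hdiff.hasDerivAt
  have hcl : z₀ ∈ closure (Metric.ball 0 ‖z₀‖) := by
    rw [closure_ball _ (norm_ne_zero_iff.mpr hz₀)]
    simp
  have hmaps : Set.MapsTo g (Metric.ball 0 ‖z₀‖) S := fun z hz => hin z (by simpa using hz)
  have hclS : g z₀ ∈ closure S :=
    hdiff.continuousAt.continuousWithinAt.mem_closure hcl hmaps
  have hSre : ∀ w ∈ S, 0 ≤ w.re := fun w hw =>
    Complex.abs_arg_le_pi_div_two_iff.mp (hw.2.le.trans hβπ)
  have hre₀ : 0 ≤ (g z₀).re :=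
    closure_minimal hSre (isClosed_le continuous_const Complex.continuous_re) hclS
  obtain ⟨H1, H2⟩ := H z₀ hz₀1
  by_cases hg0 : g z₀ = 0
  · obtain ⟨h1, h2⟩ := mul_deriv_real_nonpos_of_re_nonneg hz₀ hd (by simp [hg0])
      (fun z hz => hSre _ (hin z hz))
    rw [hg0, mul_zero, zero_add] at H1 H2
    have h3 : (z₀ * deriv g z₀).re < 0 := lt_of_le_of_ne h2 fun h => H1 (Complex.ext h h1)
    rw [Complex.arg_eq_pi_iff.mpr ⟨h3, h1⟩, abs_of_pos hπ] at H2
    linarith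
  have hslit : g z₀ ∈ slitPlane := by
    rcases hre₀.lt_or_eq with h | h
    · exact Or.inl h
    · exact Or.inr fun him => hg0 (Complex.ext h.symm him)
  have hargle : |arg (g z₀)| ≤ π / 2 * β := by
    have := mem_closure_iff_frequently.mp hclS
    by_contra! hlt
    refine this ?_
    filter_upwards [(Complex.continuousAt_arg hslit).abs.eventually_const_lt hlt] with w hw hwS
    exact lt_asymm hw hwS.2
  have hargeq : |arg (g z₀)| = π / 2 * β :=
    le_antisymm hargle (not_lt.mp fun h => hz₀S ⟨hslit, h⟩)
  obtain ⟨σ, hσ, hargσ⟩ : ∃ σ : ℝ, (σ = 1 ∨ σ = -1) ∧ arg (g z₀) = σ * (π / 2 * β) := by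
    rcases eq_or_eq_neg_of_abs_eq hargeq with h | h
    · exact ⟨1, Or.inl rfl, by rw [h, one_mul]⟩
    · exact ⟨-1, Or.inr rfl, by rw [h, neg_one_mul]⟩
  obtain ⟨K, hK, hKe⟩ := nunokawa hβ hσ hz₀
    (hg.mono (Metric.ball_subset_ball hz₀1.le)) hd h0re h0im hin hslit hargσ
  have hfac : κ * g z₀ + z₀ * deriv g z₀ = g z₀ * ((κ : ℂ) + K * I) := by rw [hKe]; ring
  have hne : (κ : ℂ) + K * I ≠ 0 := fun h => by
    have := congrArg Complex.re h
    simp at this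
    linarith
  have harg2 := arg_ofReal_add_mul_I hκ K
  have hmono : Real.arctan (β / κ) ≤ σ * Real.arctan (K / κ) := by
    have h : Real.arctan (β / κ) ≤ Real.arctan (σ * K / κ) :=
      Real.arctan_mono (div_le_div_of_nonneg_right hK hκ.le)
    rcases hσ with rfl | rfl
    · simpa using h
    · simpa [neg_div, Real.arctan_neg] using h
  have hlt := Real.arctan_lt_pi_div_two (K / κ)
  have hgt := Real.neg_pi_div_two_lt_arctan (K / κ)
  have hmem : arg (g z₀) + arg ((κ : ℂ) + K * I) ∈ Set.Ioc (-π) π := by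
    rw [harg2, hargσ]
    rcases hσ with rfl | rfl <;> constructor <;> nlinarith
  rw [hfac, Complex.arg_mul hg0 hne hmem, harg2, hargσ] at H2
  have h1 := abs_lt.mp H2
  rcases hσ with rfl | rfl <;> linarith [h1.1, h1.2]

lemma ne_zero_of_abs_arg_lt_s6 {F : ℂ → ℂ} {θ : ℝ} (hθ : θ ≤ π)
    (hF : AnalyticOnNhd ℂ F (Metric.ball 0 1)) (h0 : F 0 ≠ 0)
    (harg : ∀ z, ‖z‖ < 1 → |arg (F z)| < θ) : ∀ z, ‖z‖ < 1 → F z ≠ 0 := by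
  intro z hz hFz
  rcases hF.is_constant_or_isOpen (convex_ball (0 : ℂ) 1).isPreconnected with ⟨w, hw⟩ | h
  · exact h0 (by rw [hw 0 (by simp), ← hw z (by simpa using hz), hFz])
  · have ho : (0 : ℂ) ∈ F '' Metric.ball 0 1 := ⟨z, by simpa using hz, hFz⟩
    obtain ⟨ε, hε, hball⟩ := Metric.isOpen_iff.mp (h _ subset_rfl Metric.isOpen_ball) 0 ho
    obtain ⟨x, hx, hxe⟩ := hball (show ((-(ε / 2) : ℝ) : ℂ) ∈ Metric.ball (0 : ℂ) ε by
      rw [mem_ball_zero_iff, Complex.norm_real, norm_neg, Real.norm_of_nonneg (by positivity)]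
      linarith)
    have := harg x (by simpa using hx)
    rw [hxe, Complex.arg_ofReal_of_neg (by linarith), abs_of_pos Real.pi_pos] at this
    linarith

lemma exists_eq_pow_mul_of_iteratedDeriv_eq_zero {f : ℂ → ℂ} {p : ℕ}
    (hf : DifferentiableOn ℂ f (Metric.ball 0 1)) (h0 : ∀ k < p, iteratedDeriv k f 0 = 0) :
    ∃ g : ℂ → ℂ, DifferentiableOn ℂ g (Metric.ball 0 1) ∧
      ∀ z, ‖z‖ < 1 → f z = z ^ p * g z := by
  have hfa : AnalyticAt ℂ f 0 := hf.analyticAt (Metric.ball_mem_nhds 0 one_pos)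
  obtain ⟨g₀, hg₀, hfg⟩ := (natCast_le_analyticOrderAt hfa).mp
    ((natCast_le_analyticOrderAt_iff_iteratedDeriv_eq_zero hfa).mpr h0)
  simp only [sub_zero, smul_eq_mul] at hfg
  classical
  refine ⟨Function.update (fun z => f z / z ^ p) 0 (g₀ 0), fun z hz => ?_, fun z hz => ?_⟩
  · refine DifferentiableAt.differentiableWithinAt ?_
    by_cases hz0 : z = 0
    · subst hz0
      refine hg₀.differentiableAt.congr_of_eventuallyEq ?_
      filter_upwards [hfg] with w hw
      by_cases hw0 : w = 0
      · simp [hw0]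
      · rw [Function.update_of_ne hw0, hw]
        field_simp
    · have : DifferentiableAt ℂ (fun z => f z / z ^ p) z :=
        (hf.differentiableAt (Metric.isOpen_ball.mem_nhds hz)).div (by fun_prop)
          (pow_ne_zero _ hz0)
      refine this.congr_of_eventuallyEq ?_
      filter_upwards [isOpen_ne.mem_nhds hz0] with w hw using Function.update_of_ne hw _ _
  · by_cases hz0 : z = 0
    · subst hz0
      simpa using hfg.self_of_nhds
    · rw [Function.update_of_ne hz0]
      field_simp

/-- If `f = z ^ p * g`, then `f⁽ʲ⁾ = z ^ (p - j) * powQuotient p g j` for `j ≤ p`. -/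
noncomputable def powQuotient (p : ℕ) (g : ℂ → ℂ) : ℕ → ℂ → ℂ
  | 0 => g
  | j + 1 => fun z => ((p - j : ℕ) : ℂ) * powQuotient p g j z + z * deriv (powQuotient p g j) z

lemma differentiableOn_powQuotient {p : ℕ} {g : ℂ → ℂ}
    (hg : DifferentiableOn ℂ g (Metric.ball 0 1)) (j : ℕ) :
    DifferentiableOn ℂ (powQuotient p g j) (Metric.ball 0 1) := by
  induction j with
  | zero => exact hg
  | succ j ih => exact (ih.const_mul _).add (differentiableOn_id.mul (ih.deriv Metric.isOpen_ball))

lemma iteratedDeriv_eq_pow_mul_powQuotient {p : ℕ} {f g : ℂ → ℂ}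
    (hg : DifferentiableOn ℂ g (Metric.ball 0 1)) (hfg : ∀ z, ‖z‖ < 1 → f z = z ^ p * g z)
    {j : ℕ} (hj : j ≤ p) :
    ∀ z, ‖z‖ < 1 → iteratedDeriv j f z = z ^ (p - j) * powQuotient p g j z := by
  induction j with
  | zero => simpa [powQuotient] using hfg
  | succ j ih =>
    intro z hz
    have hz' : Metric.ball (0 : ℂ) 1 ∈ nhds z := Metric.isOpen_ball.mem_nhds (by simpa using hz)
    have hev : iteratedDeriv j f =ᶠ[nhds z] fun z => z ^ (p - j) * powQuotient p g j z := by
      filter_upwards [hz'] with w hw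
      exact ih (by omega) w (by simpa using hw)
    have hd := ((differentiableOn_powQuotient (p := p) hg j).differentiableAt hz').hasDerivAt
    obtain ⟨m, hm⟩ : ∃ m, p - j = m + 1 := ⟨p - j - 1, by omega⟩
    rw [iteratedDeriv_succ, hev.deriv_eq, HasDerivAt.deriv ((hasDerivAt_pow (p - j) z).fun_mul hd),
      show p - (j + 1) = m by omega]
    simp only [powQuotient, hm, Nat.add_sub_cancel]
    ring

lemma powQuotient_zero_pos {p : ℕ} {g : ℂ → ℂ} (hp : powQuotient p g p 0 = (p.factorial : ℂ))
    {k : ℕ} (hk : k ≤ p) :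
    0 < (powQuotient p g (p - k) 0).re ∧ (powQuotient p g (p - k) 0).im = 0 := by
  induction k with
  | zero =>
    rw [Nat.sub_zero, hp]
    exact ⟨by simpa using p.factorial_pos, by simp⟩
  | succ k ih =>
    have h := ih (by omega)
    rw [show p - k = p - (k + 1) + 1 by omega] at h
    simp only [powQuotient, zero_mul, add_zero, show p - (p - (k + 1)) = k + 1 by omega,
      ← Complex.ofReal_natCast, Complex.re_ofReal_mul, Complex.im_ofReal_mul] at h
    have hk0 : (0 : ℝ) < (k + 1 : ℕ) := by positivity
    exact ⟨pos_of_mul_pos_right h.1 hk0.le, (mul_eq_zero.mp h.2).resolve_left (ne_of_gt hk0)⟩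

/-- Let `f(z) = z^p + ⋯` be analytic in the unit disc,
`α₀ ∈ (0, 3/2]`, and `α : ℕ → ℝ` positive on `{0,…,p}` with `α 0 = α₀` and
`α k + (2/π)·arctan(α k / k) = α (k-1)` for `1 ≤ k ≤ p`.
If `|arg f^{(p)}(z)| < π·α₀/2` on the disc, then for every `k ∈ {1,…,p}`,
`|arg(f^{(p-k)}(z)/z^k)| < π·α k/2` on the punctured disc. -/
theorem stmt_6 (p : ℕ) (hp : 1 ≤ p) (f : ℂ → ℂ)
    (hf : AnalyticOnNhd ℂ f {z : ℂ | ‖z‖ < 1})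
    (hf0 : ∀ k < p, iteratedDeriv k f 0 = 0)
    (hfp : iteratedDeriv p f 0 = (p.factorial : ℂ))
    (α₀ : ℝ) (hα₀ : α₀ ∈ Set.Ioc (0 : ℝ) (3 / 2))
    (α : ℕ → ℝ) (hαpos : ∀ k ≤ p, 0 < α k) (hα0 : α 0 = α₀)
    (hrec : ∀ k, 1 ≤ k → k ≤ p →
      α k + (2 / Real.pi) * Real.arctan (α k / k) = α (k - 1))
    (harg : ∀ z : ℂ, ‖z‖ < 1 →
      |Complex.arg (iteratedDeriv p f z)| < Real.pi * α₀ / 2) :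
    ∀ k, 1 ≤ k → k ≤ p → ∀ z : ℂ, ‖z‖ < 1 → z ≠ 0 →
      |Complex.arg (iteratedDeriv (p - k) f z / z ^ k)| < Real.pi * α k / 2 := by
  have hπ := Real.pi_pos
  have hball : {z : ℂ | ‖z‖ < 1} = Metric.ball 0 1 := by ext; simp
  rw [hball] at hf
  obtain ⟨g, hg, hfg⟩ := exists_eq_pow_mul_of_iteratedDeriv_eq_zero hf.differentiableOn hf0
  have hG : ∀ {j : ℕ}, j ≤ p → ∀ z, ‖z‖ < 1 →
      iteratedDeriv j f z = z ^ (p - j) * powQuotient p g j z :=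
    fun hj => iteratedDeriv_eq_pow_mul_powQuotient hg hfg hj
  have hGp : ∀ z, ‖z‖ < 1 → powQuotient p g p z = iteratedDeriv p f z := fun z hz => by
    simp [hG le_rfl z hz]
  have hGp0 : powQuotient p g p 0 = (p.factorial : ℂ) := by rw [hGp 0 (by simp), hfp]
  have hα1 : ∀ k, k + 1 ≤ p → α (k + 1) ≤ 1 := by
    intro k hk
    induction k with
    | zero =>
      by_contra! hlt
      have h := hrec 1 le_rfl hk
      have h1 : π / 4 < Real.arctan (α 1) := by
        rw [← Real.arctan_one]
        exact Real.arctan_strictMono hlt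
      have h2 : 1 / 2 < 2 / π * Real.arctan (α 1) := by
        calc 1 / 2 = 2 / π * (π / 4) := by field_simp; norm_num
          _ < _ := by gcongr
      simp only [Nat.cast_one, div_one, Nat.sub_self, hα0] at h
      have := hα₀.2
      simp only [zero_add] at hlt
      linarith
    | succ k ih =>
      have h := hrec (k + 2) (by omega) hk
      have h1 : 0 < Real.arctan (α (k + 2) / (k + 2 : ℕ)) :=
        Real.arctan_pos.mpr (div_pos (hαpos _ hk) (by positivity))
      have h2 : 0 < 2 / π * Real.arctan (α (k + 2) / (k + 2 : ℕ)) := by positivity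
      have h3 := ih (by omega)
      rw [show k + 2 - 1 = k + 1 by omega] at h
      rw [show k + 1 + 1 = k + 2 by omega]
      linarith
  have main : ∀ k ≤ p, ∀ z, ‖z‖ < 1 → powQuotient p g (p - k) z ≠ 0 ∧
      |Complex.arg (powQuotient p g (p - k) z)| < π / 2 * α k := by
    intro k hk
    induction k with
    | zero =>
      have hlt : ∀ z : ℂ, ‖z‖ < 1 → |Complex.arg (powQuotient p g p z)| < π / 2 * α 0 :=
        fun z hz => by
          rw [hGp z hz, hα0]
          linarith [harg z hz]
      have hne := ne_zero_of_abs_arg_lt_s6 (by rw [hα0]; nlinarith [hα₀.2])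
        ((differentiableOn_powQuotient hg p).analyticOnNhd Metric.isOpen_ball)
        (by rw [hGp0]; exact_mod_cast p.factorial_ne_zero) hlt
      exact fun z hz => ⟨hne z hz, hlt z hz⟩
    | succ k ih =>
      have h0 := powQuotient_zero_pos hGp0 hk
      have hstep := sector_of_sector_mul_add_deriv (κ := (k + 1 : ℕ)) (hαpos _ hk) (hα1 k hk)
        (by positivity) (differentiableOn_powQuotient hg _) h0.1 h0.2 (fun z hz => by
          have h := ih (by omega) z hz
          have hr := hrec (k + 1) (by omega) hk
          rw [Nat.add_sub_cancel] at hr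
          rw [show p - k = p - (k + 1) + 1 by omega, ← hr] at h
          simp only [powQuotient, show p - (p - (k + 1)) = k + 1 by omega] at h
          refine ⟨by exact_mod_cast h.1, ?_⟩
          refine lt_of_lt_of_eq (by exact_mod_cast h.2) ?_
          field_simp)
      exact fun z hz => ⟨Complex.slitPlane_ne_zero (hstep z hz).1, (hstep z hz).2⟩
  intro k _ hk z hz hz0
  have h := (main k hk z hz).2
  rw [hG (Nat.sub_le p k) z hz, Nat.sub_sub_self hk, mul_div_cancel_left₀ _ (pow_ne_zero _ hz0)]
  linarith
end

section
/- Let α : ℕ → ℝ be a sequence of positive real numbers with α_0 = 3/2 and α_k + (2/π)·arctan(α_k / k) = α_{k-1} for all k ≥ 1. Then α_n → 0 as n → ∞. -/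
open Real Filter

theorem div_one_add_le_arctan {x : ℝ} (hx : 0 ≤ x) : x / (1 + x) ≤ Real.arctan x := by
  have hsqrt : √(1 + x ^ 2) ≤ 1 + x := Real.sqrt_le_iff.mpr ⟨by linarith, by nlinarith⟩
  calc x / (1 + x) ≤ x / √(1 + x ^ 2) := by gcongr
    _ = Real.sin (Real.arctan x) := (Real.sin_arctan x).symm
    _ ≤ Real.arctan x := Real.sin_le (Real.arctan_nonneg.mpr hx)

/-- A sequence whose decrements dominate a positive multiple of the harmonic series
is not bounded below. -/
theorem not_bddBelow_of_harmonic_decrements {u : ℕ → ℝ} {c : ℝ} (hc : 0 < c)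
    (hu : ∀ n : ℕ, u (n + 1) + c * (1 / ((n : ℝ) + 1)) ≤ u n) : ¬ BddBelow (Set.range u) := by
  rintro ⟨b, hb⟩
  have hsum (n : ℕ) : u n + c * ∑ i ∈ Finset.range n, 1 / ((i : ℝ) + 1) ≤ u 0 := by
    induction n with
    | zero => simp
    | succ n ih =>
      rw [Finset.sum_range_succ, mul_add]
      linarith [hu n]
  obtain ⟨n, hn⟩ :=
    ((Real.tendsto_sum_range_one_div_nat_succ_atTop.const_mul_atTop hc).eventually_gt_atTop
      (u 0 - b)).exists
  linarith [hsum n, hb ⟨n, rfl⟩]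

/-- If `α : ℕ → ℝ` is a sequence of positive reals with `α 0 = 3/2`
and `α k + (2/π)·arctan(α k / k) = α (k-1)` for all `k ≥ 1`, then `α n → 0`. -/
theorem stmt_7 (α : ℕ → ℝ) (hαpos : ∀ n, 0 < α n) (hα0 : α 0 = 3 / 2)
    (hrec : ∀ k, 1 ≤ k →
      α k + (2 / Real.pi) * Real.arctan (α k / k) = α (k - 1)) :
    Filter.Tendsto α Filter.atTop (nhds 0) := by
  have hstep (n : ℕ) :
      α (n + 1) + (2 / Real.pi) * Real.arctan (α (n + 1) / ((n : ℝ) + 1)) = α n := by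
    simpa using hrec (n + 1) (by omega)
  have hanti : Antitone α := antitone_nat_of_succ_le fun n => by
    have harctan : 0 ≤ Real.arctan (α (n + 1) / ((n : ℝ) + 1)) :=
      Real.arctan_nonneg.mpr (div_nonneg (hαpos _).le (by positivity))
    have : 0 ≤ (2 / Real.pi) * Real.arctan (α (n + 1) / ((n : ℝ) + 1)) := by positivity
    linarith [hstep n]
  have hbdd : BddBelow (Set.range α) := ⟨0, by rintro _ ⟨n, rfl⟩; exact (hαpos n).le⟩
  have hlim := tendsto_atTop_ciInf hanti hbdd
  set L := ⨅ n, α n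
  have hL : 0 ≤ L := le_ciInf fun n => (hαpos n).le
  rcases hL.eq_or_lt with hL | hL
  · rwa [← hL] at hlim
  refine absurd hbdd (not_bddBelow_of_harmonic_decrements
    (c := (2 / Real.pi) * (L / (1 + L))) (by positivity) fun n => ?_)
  have hlower : L / (1 + L) * (1 / ((n : ℝ) + 1)) ≤
      Real.arctan (α (n + 1) / ((n : ℝ) + 1)) :=
    calc L / (1 + L) * (1 / ((n : ℝ) + 1))
        = L / ((n : ℝ) + 1) / (1 + L) := by ring
      _ ≤ L / ((n : ℝ) + 1) / (1 + L / ((n : ℝ) + 1)) := by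
        gcongr
        exact div_le_self hL.le (by linarith [(Nat.cast_nonneg n : (0 : ℝ) ≤ n)])
      _ ≤ Real.arctan (L / ((n : ℝ) + 1)) := div_one_add_le_arctan (by positivity)
      _ ≤ Real.arctan (α (n + 1) / ((n : ℝ) + 1)) := by
        apply Real.arctan_mono
        gcongr
        exact ciInf_le hbdd _
  rw [← hstep n, mul_assoc]
  gcongr
end

section
/- Let α : ℕ → ℝ be a sequence of positive real numbers with α_0 = 3/2 and α_k + (2/π)·arctan(α_k / k) = α_{k-1} for all k ≥ 1, and let x : ℕ → ℝ be defined by x_0 = 2 and x_k·(1 + 1/(kπ)) = x_{k-1} for all k ≥ 1, so that x_n = 2 / ∏_{j=1}^n (1 + 1/(jπ)). Then α_n < x_n for all n ≥ 1. -/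
open Real Finset

lemma half_le_arctan {t : ℝ} (ht0 : 0 ≤ t) (ht : t ≤ 3 / 2) : t / 2 ≤ Real.arctan t := by
  rcases le_total t 1 with h1 | h1
  · have hs : Real.sin (2 * Real.arctan t) ≤ 2 * Real.arctan t :=
      Real.sin_le (by linarith [Real.arctan_nonneg.2 ht0])
    have hsin : Real.sin (2 * Real.arctan t) = 2 * (t / (1 + t ^ 2)) := by
      have hsq : √(1 + t ^ 2) ^ 2 = 1 + t ^ 2 := Real.sq_sqrt (by positivity)
      have hpos : 0 < √(1 + t ^ 2) := Real.sqrt_pos.2 (by positivity)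
      rw [Real.sin_two_mul, Real.sin_arctan, Real.cos_arctan, ← hsq]
      field_simp
      simp [hsq]
    have hle : t / 2 ≤ t / (1 + t ^ 2) :=
      div_le_div_of_nonneg_left ht0 (by positivity) (by nlinarith)
    linarith
  · have h : Real.arctan 1 ≤ Real.arctan t := Real.arctan_mono h1
    rw [Real.arctan_one] at h
    linarith [Real.pi_gt_three]

/-- With `α` the positive sequence given by `α 0 = 3/2` and
`α k + (2/π)·arctan(α k / k) = α (k-1)` for `k ≥ 1`, and `x` given by `x 0 = 2`
and `x k·(1 + 1/(kπ)) = x (k-1)` for `k ≥ 1` (so `x n = 2/∏_{j=1}^n (1+1/(jπ))`),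
we have `α n < x n` for all `n ≥ 1`. -/
theorem stmt_8 (α : ℕ → ℝ) (hαpos : ∀ n, 0 < α n) (hα0 : α 0 = 3 / 2)
    (hrec : ∀ k, 1 ≤ k →
      α k + (2 / Real.pi) * Real.arctan (α k / k) = α (k - 1))
    (x : ℕ → ℝ) (hx0 : x 0 = 2)
    (hxrec : ∀ k, 1 ≤ k → x k * (1 + 1 / (k * Real.pi)) = x (k - 1)) :
    (∀ n, 1 ≤ n → x n = 2 / ∏ j ∈ Finset.Icc 1 n, (1 + 1 / (j * Real.pi))) ∧
      ∀ n, 1 ≤ n → α n < x n := by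
  have hfac : ∀ k : ℕ, 0 < 1 + 1 / ((k : ℝ) * Real.pi) := fun k => by
    have := Real.pi_pos
    positivity
  refine ⟨fun n _ => ?_, fun n _ => ?_⟩
  · rw [eq_div_iff (Finset.prod_pos fun j _ => hfac j).ne']
    clear * - hx0 hxrec
    induction n with
    | zero => simpa using hx0
    | succ k ih =>
      have h := hxrec (k + 1) (by omega)
      rw [Nat.add_sub_cancel] at h
      rw [Finset.prod_Icc_succ_top (by omega), mul_comm (∏ _ ∈ _, _), ← mul_assoc, h, ih]
  · suffices h : α n ≤ 3 / 2 ∧ α n < x n from h.2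
    clear * - hαpos hα0 hrec hx0 hxrec hfac
    induction n with
    | zero => exact ⟨hα0.le, by rw [hα0, hx0]; norm_num⟩
    | succ k ih =>
      have hα := hrec (k + 1) (by omega)
      have hx := hxrec (k + 1) (by omega)
      rw [Nat.add_sub_cancel] at hα hx
      have hpos := hαpos (k + 1)
      have hquot : 0 ≤ α (k + 1) / ((k + 1 : ℕ) : ℝ) := by positivity
      have hstep : 0 ≤ 2 / Real.pi * Real.arctan (α (k + 1) / ((k + 1 : ℕ) : ℝ)) :=
        mul_nonneg (div_nonneg zero_le_two Real.pi_pos.le) (Real.arctan_nonneg.2 hquot)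
      have hbound : α (k + 1) ≤ 3 / 2 := by linarith [ih.1]
      refine ⟨hbound, lt_of_mul_lt_mul_right ?_ (hfac (k + 1)).le⟩
      have hatan := half_le_arctan hquot
        ((div_le_self hpos.le (by exact_mod_cast Nat.le_add_left 1 k)).trans hbound)
      have hmul := mul_le_mul_of_nonneg_left hatan (div_nonneg zero_le_two Real.pi_pos.le)
      have heq : α (k + 1) * (1 + 1 / (((k + 1 : ℕ) : ℝ) * Real.pi)) =
          α (k + 1) + 2 / Real.pi * (α (k + 1) / ((k + 1 : ℕ) : ℝ) / 2) := by
        field_simp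
      rw [hx, heq]
      linarith [ih.2]
end
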